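/- arXiv:2206.03558 — 6 statements merged into one kernel-verified Lean document; each statement's English description precedes it below -/
import Mathlib

section
/- Let G be a group and F ≤ G a subgroup with G = F·FC_G(F). Let (X,π) be a uniformly convex isometric Banach G-module without almost invariant unit vectors and with X^{FC_G(F)} = {0}. Then the restriction map H¹(G,X) → H¹(F,X) is zero; equivalently, every cocycle φ ∈ Z¹(G,X) restricts on F to a coboundary, i.e. there is x ∈ X with φ(f) = x − π(f)x for all f ∈ F. -/
noncomputable section

open scoped BigOperators

variable {G : Type*} [Group G] {X : Type*} [NormedAddCommGroup X] [NormedSpace ℝ X]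

/-- `FC_G(F)`: the set of elements of `G` with finite `F`-conjugacy class. -/
def FCset (F : Subgroup G) : Set G :=
  {g | Set.Finite {x | ∃ f ∈ F, x = f * g * f⁻¹}}

/-- `(X,π)` has almost invariant unit vectors. -/
def HasAIUV (π : G →* (X →L[ℝ] X)) : Prop :=
  ∀ E : Finset G, ∀ ε : ℝ, 0 < ε →
    ∃ x : X, ‖x‖ = 1 ∧ ∀ g ∈ E, ‖x - π g x‖ < ε

/-- The degree-1 cocycle condition; `Z¹(G,X)` is the set of such maps. -/
def IsCocycle (π : G →* (X →L[ℝ] X)) (φ : G → X) : Prop :=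
  ∀ g f : G, φ (g * f) = π g (φ f) + φ g

/-- The average of the operators `π g` over a finite set `S`. -/
def avgOp (π : G →* (X →L[ℝ] X)) (S : Finset G) : X →L[ℝ] X :=
  (S.card : ℝ)⁻¹ • ∑ g ∈ S, π g

theorem avgOp_apply (π : G →* (X →L[ℝ] X)) (S : Finset G) (x : X) :
    avgOp π S x = (S.card : ℝ)⁻¹ • ∑ g ∈ S, π g x := by
  simp [avgOp]

theorem norm_average_le {ι : Type*} (S : Finset ι) (u : ι → X) {r : ℝ} (hr : 0 ≤ r)
    (hu : ∀ i ∈ S, ‖u i‖ ≤ r) : ‖(S.card : ℝ)⁻¹ • ∑ i ∈ S, u i‖ ≤ r := by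
  rw [norm_smul, norm_inv, RCLike.norm_natCast]
  rcases S.eq_empty_or_nonempty with rfl | hS
  · simpa using hr
  have hc : (0 : ℝ) < S.card := by exact_mod_cast hS.card_pos
  rw [inv_mul_le_iff₀ hc, ← nsmul_eq_mul]
  exact (norm_sum_le _ _).trans (Finset.sum_le_card_nsmul _ _ _ hu)

theorem norm_avgOp_apply_le {π : G →* (X →L[ℝ] X)} (hiso : ∀ (g : G) (x : X), ‖π g x‖ = ‖x‖)
    (S : Finset G) (x : X) : ‖avgOp π S x‖ ≤ ‖x‖ := by
  rw [avgOp_apply]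
  exact norm_average_le S _ (norm_nonneg x) fun g _ => (hiso g x).le

theorem average_sub_eq {ι : Type*} {S : Finset ι} (hS : S.Nonempty) (u : ι → X) (x : X) :
    (S.card : ℝ)⁻¹ • ∑ i ∈ S, (x - u i) = x - (S.card : ℝ)⁻¹ • ∑ i ∈ S, u i := by
  have hc : (S.card : ℝ) ≠ 0 := by exact_mod_cast hS.card_pos.ne'
  rw [Finset.sum_sub_distrib, Finset.sum_const, smul_sub, ← Nat.cast_smul_eq_nsmul ℝ,
    inv_smul_smul₀ hc]

theorem UniformConvexSpace.exists_norm_add_le [UniformConvexSpace X] {ε : ℝ} (hε : 0 < ε) :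
    ∃ δ > 0, ∀ r : ℝ, 0 ≤ r → ∀ x y : X, ‖x‖ ≤ r → ‖y‖ ≤ r → ε * r ≤ ‖x - y‖ →
      ‖x + y‖ ≤ (2 - δ) * r := by
  obtain ⟨δ, hδ, h⟩ := exists_forall_closed_ball_dist_add_le_two_sub X hε
  refine ⟨δ, hδ, fun r hr x y hx hy hxy => ?_⟩
  rcases hr.eq_or_lt with rfl | hr
  · have hx0 : x = 0 := norm_le_zero_iff.1 hx
    have hy0 : y = 0 := norm_le_zero_iff.1 hy
    simp [hx0, hy0]
  have key : ∀ z : X, ‖r⁻¹ • z‖ = ‖z‖ / r := fun z => by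
    rw [norm_smul, norm_inv, Real.norm_of_nonneg hr.le, div_eq_inv_mul]
  have := @h (r⁻¹ • x) (by rw [key]; exact (div_le_one hr).2 hx) (r⁻¹ • y)
    (by rw [key]; exact (div_le_one hr).2 hy)
    (by rw [← smul_sub, key]; exact (le_div_iff₀ hr).2 hxy)
  rwa [← smul_add, key, div_le_iff₀ hr] at this

theorem exists_norm_avgOp_le [UniformConvexSpace X] {π : G →* (X →L[ℝ] X)}
    (hiso : ∀ (g : G) (x : X), ‖π g x‖ = ‖x‖) {S : Finset G} (hS : 1 ∈ S) {ε : ℝ} (hε : 0 < ε) :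
    ∃ η > 0, ∀ x : X, ∀ g ∈ S, ε * ‖x‖ ≤ ‖x - π g x‖ → ‖avgOp π S x‖ ≤ (1 - η) * ‖x‖ := by
  classical
  obtain ⟨δ, hδ, h⟩ := UniformConvexSpace.exists_norm_add_le (X := X) hε
  have hc : (0 : ℝ) < S.card := by exact_mod_cast Finset.card_pos.2 ⟨1, hS⟩
  refine ⟨δ / S.card, by positivity, fun x g hg hx => ?_⟩
  by_cases hg1 : g = 1
  · have hx0 : x = 0 := by
      rw [hg1] at hx
      simp only [map_one, one_apply_eq_self, sub_self, norm_zero] at hx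
      exact norm_le_zero_iff.1 (nonpos_of_mul_nonpos_right hx hε)
    simp [hx0]
  have hg' : g ∈ S.erase 1 := Finset.mem_erase.2 ⟨hg1, hg⟩
  have hpair := h ‖x‖ (norm_nonneg x) x (π g x) le_rfl (hiso g x).le hx
  have hrest : ‖∑ s ∈ (S.erase 1).erase g, π s x‖ ≤ ((S.card : ℝ) - 2) * ‖x‖ := by
    have h1 := Finset.card_erase_add_one hS
    have h2 := Finset.card_erase_add_one hg'
    have hcard : (((S.erase 1).erase g).card : ℝ) = S.card - 2 := by
      rw [← h1, ← h2]; push_cast; ring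
    rw [← hcard, ← nsmul_eq_mul]
    exact (norm_sum_le _ _).trans (Finset.sum_le_card_nsmul _ _ _ fun s _ => (hiso s x).le)
  rw [avgOp_apply, norm_smul, norm_inv, RCLike.norm_natCast, inv_mul_le_iff₀ hc,
    ← Finset.add_sum_erase _ _ hS, ← Finset.add_sum_erase _ _ hg', map_one, ← add_assoc]
  have hcδ : (S.card : ℝ) * ((1 - δ / S.card) * ‖x‖) = (S.card - δ) * ‖x‖ := by field_simp
  rw [hcδ]
  refine (norm_add_le _ _).trans ?_
  simp only [one_apply_eq_self]
  linarith

theorem apply_eq_of_norm_le_norm_avgOp [UniformConvexSpace X] {π : G →* (X →L[ℝ] X)}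
    (hiso : ∀ (g : G) (x : X), ‖π g x‖ = ‖x‖) {S : Finset G} (hS : 1 ∈ S) {x : X}
    (hx : ‖x‖ ≤ ‖avgOp π S x‖) {g : G} (hg : g ∈ S) : π g x = x := by
  by_contra hne
  have hd : 0 < ‖x - π g x‖ := norm_pos_iff.2 (sub_ne_zero.2 (Ne.symm hne))
  have hx0 : 0 < ‖x‖ := norm_pos_iff.2 fun h => hne (by simp [h])
  obtain ⟨η, hη, h⟩ := exists_norm_avgOp_le hiso hS (div_pos hd hx0)
  have := h x g hg (by rw [div_mul_cancel₀ _ hx0.ne'])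
  nlinarith [mul_pos hη hx0]

/-- A nonempty convex set in a uniformly convex Banach space has a point of least norm in its
closure. -/
theorem Convex.exists_mem_closure_norm_le [CompleteSpace X] [UniformConvexSpace X] {K : Set X}
    (hK : Convex ℝ K) (hne : K.Nonempty) : ∃ c ∈ closure K, ∀ z ∈ closure K, ‖c‖ ≤ ‖z‖ := by
  set d : ℝ := sInf (norm '' K) with hd
  have hbdd : BddBelow (norm '' K) := ⟨0, by rintro _ ⟨x, _, rfl⟩; exact norm_nonneg x⟩
  have hdle : ∀ z ∈ K, d ≤ ‖z‖ := fun z hz => csInf_le hbdd ⟨z, hz, rfl⟩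
  have hdle' : ∀ z ∈ closure K, d ≤ ‖z‖ := fun z hz =>
    closure_minimal (t := {z : X | d ≤ ‖z‖}) hdle (isClosed_le continuous_const continuous_norm) hz
  have hd0 : 0 ≤ d := le_csInf (hne.image _) (by rintro _ ⟨x, _, rfl⟩; exact norm_nonneg x)
  have hex : ∀ n : ℕ, ∃ x ∈ K, ‖x‖ < d + 1 / ((n : ℝ) + 1) := fun n => by
    obtain ⟨_, ⟨x, hx, rfl⟩, hlt⟩ :=
      exists_lt_of_csInf_lt (hne.image norm) (lt_add_of_pos_right d Nat.one_div_pos_of_nat)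
    exact ⟨x, hx, hlt⟩
  choose u huK hu using hex
  have hcauchy : CauchySeq u := by
    refine Metric.cauchySeq_iff'.2 fun ε hε => ?_
    obtain ⟨δ, hδ, h⟩ :=
      UniformConvexSpace.exists_norm_add_le (X := X) (div_pos hε (by linarith : 0 < d + 1))
    obtain ⟨N, hN⟩ : ∃ N : ℕ, 1 / ((N : ℝ) + 1) < min (ε / 2) (δ * d / 2) ∨
        (d = 0 ∧ 1 / ((N : ℝ) + 1) < ε / 2) := by
      rcases hd0.eq_or_lt with h0 | h0
      · obtain ⟨N, hN⟩ := exists_nat_one_div_lt (half_pos hε)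
        exact ⟨N, Or.inr ⟨h0.symm, hN⟩⟩
      · obtain ⟨N, hN⟩ :=
          exists_nat_one_div_lt (lt_min (half_pos hε) (by positivity : 0 < δ * d / 2))
        exact ⟨N, Or.inl hN⟩
    refine ⟨N, fun n hn => ?_⟩
    rw [dist_eq_norm]
    have hNpos : 0 < 1 / ((N : ℝ) + 1) := Nat.one_div_pos_of_nat
    have hn1 : 1 / ((n : ℝ) + 1) ≤ 1 / ((N : ℝ) + 1) := Nat.one_div_le_one_div hn
    have hN1 : 1 / ((N : ℝ) + 1) ≤ 1 := by
      rw [div_le_one (by positivity)]; linarith [Nat.cast_nonneg (α := ℝ) N]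
    have hun := hu n
    have huN := hu N
    rcases hN with hN | ⟨h0, hN⟩
    · by_contra! hge
      set t := 1 / ((N : ℝ) + 1)
      have hadd := h (d + t) (by linarith) (u n) (u N) (by linarith) huN.le
        (le_trans (by
          rw [div_mul_eq_mul_div, div_le_iff₀ (by linarith)]
          exact mul_le_mul_of_nonneg_left (by linarith) hε.le) hge)
      have hmid := hdle _ (hK (huK n) (huK N) (by norm_num : (0 : ℝ) ≤ 1 / 2)
        (by norm_num : (0 : ℝ) ≤ 1 / 2) (by norm_num))
      rw [← smul_add, norm_smul, Real.norm_of_nonneg (by norm_num)] at hmid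
      have := hN.trans_le (min_le_right _ _)
      nlinarith [mul_pos hδ hNpos]
    · linarith [norm_sub_le (u n) (u N)]
  obtain ⟨c, hc⟩ := cauchySeq_tendsto_of_complete hcauchy
  refine ⟨c, mem_closure_of_tendsto hc (Filter.Eventually.of_forall huK), fun z hz => ?_⟩
  have hlim : Filter.Tendsto (fun n : ℕ => d + 1 / ((n : ℝ) + 1)) Filter.atTop (nhds (d + 0)) :=
    tendsto_const_nhds.add tendsto_one_div_add_atTop_nhds_zero_nat
  rw [add_zero] at hlim
  exact (le_of_tendsto_of_tendsto' hc.norm hlim fun n => (hu n).le).trans (hdle' z hz)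

theorem ContinuousLinearMap.exists_two_smul_sub_eq [CompleteSpace X] (D : X →L[ℝ] X) {η : ℝ}
    (hη : 0 < η) (hD : ∀ x, ‖D x‖ ≤ (2 - η) * ‖x‖) (y : X) : ∃ x, (2 : ℝ) • x - D x = y := by
  have hlt : ‖(2 : ℝ)⁻¹ • D‖ < 1 := by
    refine (ContinuousLinearMap.opNorm_le_bound _ (le_max_right (1 - η / 2) 0) fun x => ?_).trans_lt
      (max_lt (by linarith) one_pos)
    rw [smul_apply, norm_smul, Real.norm_of_nonneg (by norm_num)]
    have h1 := mul_le_mul_of_nonneg_right (le_max_left (1 - η / 2) 0) (norm_nonneg x)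
    linarith [hD x]
  set U := Units.oneSub _ hlt with hU
  refine ⟨(2 : ℝ)⁻¹ • (U⁻¹ : (X →L[ℝ] X)ˣ).val y, ?_⟩
  have h : (U.val * (U⁻¹ : (X →L[ℝ] X)ˣ).val) y = y := by
    rw [Units.mul_inv]; rfl
  rw [smul_inv_smul₀ two_ne_zero, map_smul]
  simpa [hU, mul_apply_eq_comp] using h

theorem not_hasAIUV_exists {π : G →* (X →L[ℝ] X)} (h : ¬ HasAIUV π) :
    ∃ E : Finset G, ∃ ε > 0, ∀ x : X, x ≠ 0 → ∃ g ∈ E, ε * ‖x‖ ≤ ‖x - π g x‖ := by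
  simp only [HasAIUV, not_forall, not_exists, not_and, not_lt] at h
  obtain ⟨E, ε, hε, h⟩ := h
  refine ⟨E, ε, hε, fun x hx => ?_⟩
  have hpos : 0 < ‖x‖ := norm_pos_iff.2 hx
  obtain ⟨g, hg, hle⟩ := h (‖x‖⁻¹ • x) (norm_smul_inv_norm (𝕜 := ℝ) hx)
  refine ⟨g, hg, ?_⟩
  rwa [map_smul, ← smul_sub, norm_smul, norm_inv, norm_norm, le_inv_mul_iff₀ hpos,
    mul_comm] at hle

theorem FCset.exists_conj_invariant_finset {F : Subgroup G} (T : Finset G)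
    (hT : ∀ t ∈ T, t ∈ FCset F) :
    ∃ S : Finset G, 1 ∈ S ∧ T ⊆ S ∧ ∀ f ∈ F, ∀ s ∈ S, f * s * f⁻¹ ∈ S := by
  classical
  have hfin : Set.Finite (insert 1 (⋃ t ∈ T, {x | ∃ f ∈ F, x = f * t * f⁻¹})) :=
    (T.finite_toSet.biUnion fun t ht => hT t ht).insert 1
  refine ⟨hfin.toFinset, by simp, fun t ht => ?_, fun f hf s hs => ?_⟩
  · rw [Set.Finite.mem_toFinset]
    exact Or.inr (Set.mem_biUnion ht ⟨1, F.one_mem, by simp⟩)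
  · rw [Set.Finite.mem_toFinset] at hs ⊢
    rcases hs with rfl | hs
    · left; simp
    · simp only [Set.mem_iUnion] at hs
      obtain ⟨t, ht, k, hk, rfl⟩ := hs
      exact Or.inr (Set.mem_biUnion ht ⟨f * k, F.mul_mem hf hk, by group⟩)

theorem Finset.sum_conj_eq {M : Type*} [AddCommMonoid M] {F : Subgroup G} {S : Finset G}
    (hS : ∀ f ∈ F, ∀ s ∈ S, f * s * f⁻¹ ∈ S) {f : G} (hf : f ∈ F) (u : G → M) :
    ∑ s ∈ S, u (f * s * f⁻¹) = ∑ s ∈ S, u s := by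
  refine Finset.sum_equiv (MulAut.conj f).toEquiv (fun s => ⟨hS f hf s, fun h => ?_⟩) fun s _ => rfl
  have := hS f⁻¹ (F.inv_mem hf) _ h
  simpa [mul_assoc] using this

/-- Contractions commuting with `F` which change `φ` on `F` only by a coboundary. -/
def cohomContractions (π : G →* (X →L[ℝ] X)) (F : Subgroup G) (φ : G → X) : Set (X →L[ℝ] X) :=
  {m | (∀ x, ‖m x‖ ≤ ‖x‖) ∧ (∀ f ∈ F, ∀ x, m (π f x) = π f (m x)) ∧
    ∃ v, ∀ f ∈ F, φ f - m (φ f) = v - π f v}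

theorem one_mem_cohomContractions (π : G →* (X →L[ℝ] X)) (F : Subgroup G) (φ : G → X) :
    1 ∈ cohomContractions π F φ :=
  ⟨fun _ => le_rfl, fun _ _ _ => rfl, 0, fun f _ => by simp⟩

theorem mul_mem_cohomContractions {π : G →* (X →L[ℝ] X)} {F : Subgroup G} {φ : G → X}
    {m n : X →L[ℝ] X} (hm : m ∈ cohomContractions π F φ) (hn : n ∈ cohomContractions π F φ) :
    m * n ∈ cohomContractions π F φ := by
  obtain ⟨hm1, hm2, v, hv⟩ := hm
  obtain ⟨hn1, hn2, w, hw⟩ := hn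
  refine ⟨fun x => (hm1 _).trans (hn1 x), fun f hf x => ?_, v + m w, fun f hf => ?_⟩
  · simp [hn2 f hf, hm2 f hf]
  · have h1 := hv f hf
    have h2 := congrArg m (hw f hf)
    simp only [map_sub, hm2 f hf] at h2
    rw [mul_apply_eq_comp, map_add]
    calc φ f - m (n (φ f)) = (φ f - m (φ f)) + (m (φ f) - m (n (φ f))) := by abel
      _ = _ := by rw [h1, h2]; abel

theorem convex_cohomContractions (π : G →* (X →L[ℝ] X)) (F : Subgroup G) (φ : G → X) :
    Convex ℝ (cohomContractions π F φ) := by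
  rintro m ⟨hm1, hm2, v, hv⟩ n ⟨hn1, hn2, w, hw⟩ a b ha hb hab
  refine ⟨fun x => ?_, fun f hf x => ?_, a • v + b • w, fun f hf => ?_⟩
  · have h1 : ‖a • m x + b • n x‖ ≤ a * ‖m x‖ + b * ‖n x‖ := by
      refine (norm_add_le _ _).trans ?_
      rw [norm_smul, norm_smul, Real.norm_of_nonneg ha, Real.norm_of_nonneg hb]
    refine h1.trans ?_
    calc a * ‖m x‖ + b * ‖n x‖ ≤ a * ‖x‖ + b * ‖x‖ := by gcongr <;> simp_all
      _ = ‖x‖ := by rw [← add_mul, hab, one_mul]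
  · simp [hm2 f hf, hn2 f hf]
  · have h : φ f = a • φ f + b • φ f := by rw [← add_smul, hab, one_smul]
    calc φ f - (a • m + b • n) (φ f) = (a • φ f + b • φ f) - (a • m (φ f) + b • n (φ f)) := by
          rw [← h]; rfl
      _ = a • (φ f - m (φ f)) + b • (φ f - n (φ f)) := by
          simp only [smul_sub]; abel
      _ = _ := by
          rw [hv f hf, hw f hf, map_add, map_smul, map_smul]
          simp only [smul_sub]; abel

theorem avgOp_mem_cohomContractions {π : G →* (X →L[ℝ] X)}
    (hiso : ∀ (g : G) (x : X), ‖π g x‖ = ‖x‖) {F : Subgroup G} {φ : G → X} (hφ : IsCocycle π φ)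
    {S : Finset G} (hne : S.Nonempty) (hS : ∀ f ∈ F, ∀ s ∈ S, f * s * f⁻¹ ∈ S) :
    avgOp π S ∈ cohomContractions π F φ := by
  refine ⟨norm_avgOp_apply_le hiso S, fun f hf x => ?_, (S.card : ℝ)⁻¹ • ∑ s ∈ S, φ s,
    fun f hf => ?_⟩
  · rw [avgOp_apply, avgOp_apply, map_smul, map_sum, ← Finset.sum_conj_eq hS hf]
    congr 1
    refine Finset.sum_congr rfl fun s _ => ?_
    simp only [← mul_apply_eq_comp, ← map_mul]
    simp [mul_assoc]
  · have hsum : ∑ s ∈ S, (φ f - π s (φ f)) = ∑ s ∈ S, (φ s - π f (φ s)) := by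
      have h1 := Finset.sum_conj_eq hS hf fun s => φ s + π s (φ f)
      have h2 : ∀ s, φ (f * s * f⁻¹) + π (f * s * f⁻¹) (φ f) = π f (φ s) + φ f := fun s => by
        rw [← hφ f s, add_comm, ← hφ]
        simp
      simp only [h2, Finset.sum_add_distrib] at h1
      simp only [Finset.sum_sub_distrib]
      rw [sub_eq_sub_iff_add_eq_add, add_comm, h1]
    rw [avgOp_apply, ← average_sub_eq hne, hsum, Finset.sum_sub_distrib, smul_sub, map_smul,
      map_sum]

theorem exists_cohomContraction_norm_lt [CompleteSpace X] [UniformConvexSpace X]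
    {π : G →* (X →L[ℝ] X)} (hiso : ∀ (g : G) (x : X), ‖π g x‖ = ‖x‖) {F : Subgroup G}
    (hinv : ∀ x : X, (∀ g ∈ FCset F, π g x = x) → x = 0) {φ : G → X} (hφ : IsCocycle π φ)
    (y : X) {ε : ℝ} (hε : 0 < ε) : ∃ m ∈ cohomContractions π F φ, ‖m y‖ < ε := by
  classical
  set K : Set X := (fun m : X →L[ℝ] X => m y) '' cohomContractions π F φ with hKdef
  have hK : Convex ℝ K :=
    (convex_cohomContractions π F φ).linear_image (ContinuousLinearMap.apply ℝ X y).toLinearMap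
  obtain ⟨c, hc, hmin⟩ := hK.exists_mem_closure_norm_le
    ⟨_, 1, one_mem_cohomContractions π F φ, rfl⟩
  have hc0 : c = 0 := hinv c fun g hg => by
    obtain ⟨S, h1, hgS, hS⟩ := FCset.exists_conj_invariant_finset (F := F) {g} (by simpa using hg)
    refine apply_eq_of_norm_le_norm_avgOp hiso h1 (hmin _ ?_) (hgS (Finset.mem_singleton_self g))
    refine map_mem_closure (avgOp π S).continuous hc ?_
    rintro _ ⟨m, hm, rfl⟩
    exact ⟨_, mul_mem_cohomContractions (avgOp_mem_cohomContractions hiso hφ ⟨1, h1⟩ hS) hm, rfl⟩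
  obtain ⟨_, ⟨m, hm, rfl⟩, hlt⟩ := Metric.mem_closure_iff.1 hc ε hε
  exact ⟨m, hm, by simpa [hc0, dist_eq_norm] using hlt⟩

theorem exists_cohomContraction_forall_norm_lt [CompleteSpace X] [UniformConvexSpace X]
    {π : G →* (X →L[ℝ] X)} (hiso : ∀ (g : G) (x : X), ‖π g x‖ = ‖x‖) {F : Subgroup G}
    (hinv : ∀ x : X, (∀ g ∈ FCset F, π g x = x) → x = 0) {φ : G → X} (hφ : IsCocycle π φ)
    {ι : Type*} (S : Finset ι) (y : ι → X) {ε : ℝ} (hε : 0 < ε) :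
    ∃ m ∈ cohomContractions π F φ, ∀ i ∈ S, ‖m (y i)‖ < ε := by
  classical
  induction S using Finset.induction_on with
  | empty => exact ⟨1, one_mem_cohomContractions π F φ, by simp⟩
  | insert i S _ ih =>
    obtain ⟨m, hm, hmS⟩ := ih
    obtain ⟨n, hn, hni⟩ := exists_cohomContraction_norm_lt hiso hinv hφ (m (y i)) hε
    refine ⟨n * m, mul_mem_cohomContractions hn hm, fun j hj => ?_⟩
    rcases Finset.mem_insert.1 hj with rfl | hj
    · exact hni
    · exact (hn.1 _).trans_lt (hmS j hj)

theorem exists_avgOp_add_avgOp_contraction [UniformConvexSpace X]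
    {π : G →* (X →L[ℝ] X)} (hiso : ∀ (g : G) (x : X), ‖π g x‖ = ‖x‖) {F : Subgroup G}
    (hdec : ∀ g : G, ∃ f ∈ F, ∃ h ∈ FCset F, g = f * h) (hnaiuv : ¬ HasAIUV π) :
    ∃ S T : Finset G, 1 ∈ S ∧ (∀ f ∈ F, ∀ s ∈ S, f * s * f⁻¹ ∈ S) ∧ 1 ∈ T ∧ (∀ t ∈ T, t ∈ F) ∧
      ∃ η > 0, ∀ x, ‖(avgOp π S + avgOp π T) x‖ ≤ (2 - η) * ‖x‖ := by
  classical
  obtain ⟨E, ε, hε, hE⟩ := not_hasAIUV_exists hnaiuv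
  choose p hpF q hq hpq using hdec
  obtain ⟨S, hS1, hqS, hS⟩ := FCset.exists_conj_invariant_finset (F := F) (E.image q) (by
    simp only [Finset.mem_image]; rintro _ ⟨g, _, rfl⟩; exact hq g)
  have hT1 : (1 : G) ∈ insert 1 (E.image p) := Finset.mem_insert_self _ _
  obtain ⟨η₁, hη₁, h₁⟩ := exists_norm_avgOp_le hiso hS1 (half_pos hε)
  obtain ⟨η₂, hη₂, h₂⟩ := exists_norm_avgOp_le hiso hT1 (half_pos hε)
  refine ⟨S, insert 1 (E.image p), hS1, hS, hT1, ?_, min η₁ η₂, lt_min hη₁ hη₂, fun x => ?_⟩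
  · simp only [Finset.mem_insert, Finset.mem_image]
    rintro _ (rfl | ⟨g, _, rfl⟩)
    exacts [F.one_mem, hpF g]
  rcases eq_or_ne x 0 with rfl | hx
  · simp
  obtain ⟨g, hg, hle⟩ := hE x hx
  have htri : ‖x - π g x‖ ≤ ‖x - π (p g) x‖ + ‖x - π (q g) x‖ := by
    rw [← hiso (p g) (x - π (q g) x)]
    refine le_trans (le_of_eq ?_) (norm_add_le _ _)
    conv_lhs => rw [hpq g]
    rw [map_mul, mul_apply_eq_comp, map_sub]
    congr 1; abel
  have hS' := norm_avgOp_apply_le hiso S x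
  have hT' := norm_avgOp_apply_le hiso (insert 1 (E.image p)) x
  rw [add_apply]
  refine (norm_add_le _ _).trans ?_
  have hm₁ := mul_le_mul_of_nonneg_right (min_le_left η₁ η₂) (norm_nonneg x)
  have hm₂ := mul_le_mul_of_nonneg_right (min_le_right η₁ η₂) (norm_nonneg x)
  rcases le_or_gt (ε / 2 * ‖x‖) ‖x - π (p g) x‖ with hp | hp
  · have := h₂ x (p g) (Finset.mem_insert_of_mem (Finset.mem_image_of_mem p hg)) hp
    linarith
  · have := h₁ x (q g) (hqS (Finset.mem_image_of_mem q hg)) (by linarith)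
    linarith

/-- Cesàro means of a contraction `A` make `x - A x` arbitrarily small. -/
theorem exists_contraction_norm_sub_lt (A : X →L[ℝ] X) (hA : ∀ x, ‖A x‖ ≤ ‖x‖) (w : X) {ε : ℝ}
    (hε : 0 < ε) : ∃ C : X →L[ℝ] X, (∀ x, ‖C x‖ ≤ ‖x‖) ∧
      (∀ B : X →L[ℝ] X, Commute A B → Commute C B) ∧ (∀ x, A x = x → C x = x) ∧ ‖C w - A (C w)‖ < ε := by
  have hpow : ∀ (n : ℕ) (x : X), ‖(A ^ n) x‖ ≤ ‖x‖ := fun n => by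
    induction n with
    | zero => intro x; simp
    | succ n ih => intro x; rw [pow_succ]; exact (ih _).trans (hA x)
  obtain ⟨n, hn⟩ := exists_nat_gt (2 * ‖w‖ / ε)
  have hn0 : (0 : ℝ) < n := (by positivity : 0 ≤ 2 * ‖w‖ / ε).trans_lt hn
  refine ⟨(n : ℝ)⁻¹ • ∑ i ∈ Finset.range n, A ^ i, fun x => ?_, fun B hB => ?_, fun x hx => ?_, ?_⟩
  · have := norm_average_le (Finset.range n) (fun i => (A ^ i) x) (norm_nonneg x)
      fun i _ => hpow i x
    simpa [sum_apply] using this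
  · exact (Commute.sum_left _ _ _ fun i _ => hB.pow_left i).smul_left _
  · have hfix : ∀ i : ℕ, (A ^ i) x = x := fun i => by
      induction i with
      | zero => simp
      | succ i ih => rw [pow_succ, mul_apply_eq_comp, hx, ih]
    rw [smul_apply, sum_apply]
    simp only [hfix, Finset.sum_const, Finset.card_range]
    rw [← Nat.cast_smul_eq_nsmul ℝ, inv_smul_smul₀ hn0.ne']
  · have h : ((n : ℝ)⁻¹ • ∑ i ∈ Finset.range n, A ^ i) w -
        A (((n : ℝ)⁻¹ • ∑ i ∈ Finset.range n, A ^ i) w) = (n : ℝ)⁻¹ • (w - (A ^ n) w) := by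
      have := congrArg (fun D : X →L[ℝ] X => D w) (mul_neg_geom_sum A n)
      simp only [mul_apply_eq_comp, sub_apply,
        one_apply_eq_self] at this
      rw [smul_apply, map_smul, ← smul_sub, this]
    rw [h, norm_smul, norm_inv, RCLike.norm_natCast, inv_mul_lt_iff₀ hn0]
    rw [div_lt_iff₀ hε] at hn
    linarith [norm_sub_le w ((A ^ n) w), hpow n w]

/-- If `G = F · FC_G(F)` and `(X,π)` is a uniformly convex isometric Banach `G`-module
without almost invariant unit vectors and with `X^{FC_G(F)} = {0}`, then the restriction
map `H¹(G,X) → H¹(F,X)` is zero: every cocycle `φ ∈ Z¹(G,X)` restricts to a coboundary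
on `F`. -/
theorem restriction_H1_zero [CompleteSpace X] [UniformConvexSpace X]
    (π : G →* (X →L[ℝ] X)) (hiso : ∀ (g : G) (x : X), ‖π g x‖ = ‖x‖)
    (F : Subgroup G) (hdec : ∀ g : G, ∃ f ∈ F, ∃ h ∈ FCset F, g = f * h)
    (hnaiuv : ¬ HasAIUV π)
    (hinv : ∀ x : X, (∀ g ∈ FCset F, π g x = x) → x = 0) :
    ∀ φ : G → X, IsCocycle π φ → ∃ x : X, ∀ f ∈ F, φ f = x - π f x := by
  classical
  intro φ hφ
  obtain ⟨S, T, hS1, hS, hT1, hTF, η, hη, hAB⟩ :=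
    exists_avgOp_add_avgOp_contraction hiso hdec hnaiuv
  obtain ⟨hA, hcomm, v, hv⟩ := avgOp_mem_cohomContractions hiso hφ ⟨1, hS1⟩ hS
  set A := avgOp π S
  set B := avgOp π T with hB
  have hTne : T.Nonempty := ⟨1, hT1⟩
  have hlow : ∀ x, η * ‖x‖ ≤ ‖(x - A x) + (x - B x)‖ := fun x => by
    have h1 : (2 : ℝ) • x - (A + B) x = (x - A x) + (x - B x) := by
      rw [two_smul, add_apply]; abel
    rw [← h1]
    have h2 := norm_sub_norm_le ((2 : ℝ) • x) ((A + B) x)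
    rw [norm_smul, Real.norm_of_nonneg (by norm_num)] at h2
    linarith [hAB x]
  have hsubB : ∀ x, (T.card : ℝ)⁻¹ • ∑ t ∈ T, (x - π t x) = x - B x := fun x => by
    rw [average_sub_eq hTne, hB, avgOp_apply]
  have hAB_comm : ∀ x, A (B x) = B (A x) := fun x => by
    rw [hB, avgOp_apply π T x, avgOp_apply π T (A x), map_smul, map_sum]
    congr 1
    exact Finset.sum_congr rfl fun t ht => hcomm t (hTF t ht) x
  set b : X := (T.card : ℝ)⁻¹ • ∑ t ∈ T, φ t with hb
  have hbv : b - A b = v - B v := by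
    rw [← hsubB v, ← Finset.sum_congr rfl fun t ht => hv t (hTF t ht), hb, map_smul, map_sum,
      Finset.sum_sub_distrib, smul_sub]
  obtain ⟨x, hx⟩ := (A + B).exists_two_smul_sub_eq hη hAB (v + b)
  rw [add_apply, two_smul] at hx
  set ψ : G → X := fun f => φ f - (x - π f x) with hψ
  have hvb : v - (x - A x) = -(b - (x - B x)) := by
    rw [eq_neg_iff_add_eq_zero, ← sub_eq_zero.2 hx.symm]; abel
  have hb0 : b - (x - B x) = 0 := by
    set b' := b - (x - B x) with hb'
    have h1 : b' - A b' = (v - (x - A x)) - B (v - (x - A x)) := by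
      simp only [hb', map_sub, hAB_comm]
      calc _ = (b - A b) - (x - B x) + (A x - B (A x)) := by abel
        _ = _ := by rw [hbv]; abel
    have h2 : (b' - A b') + (b' - B b') = 0 := by
      rw [h1, hvb, map_neg]; abel
    have h3 := hlow b'
    rw [h2, norm_zero] at h3
    exact norm_le_zero_iff.1 (nonpos_of_mul_nonpos_right h3 hη)
  have hv0 : v = x - A x := by
    rw [hb0, neg_zero] at hvb; exact sub_eq_zero.1 hvb
  have hAψ : ∀ f ∈ F, A (ψ f) = ψ f := fun f hf => by
    have h := hv f hf
    rw [hv0, map_sub, ← hcomm f hf] at h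
    simp only [hψ, map_sub]
    rw [eq_comm, ← sub_eq_zero] at h ⊢
    rw [← neg_eq_zero, ← h]; abel
  have hψT : (T.card : ℝ)⁻¹ • ∑ t ∈ T, ψ t = 0 := by
    rw [hψ, Finset.sum_sub_distrib, smul_sub, hsubB]; exact hb0
  suffices hzero : ∀ f ∈ F, ψ f = 0 from ⟨x, fun f hf => sub_eq_zero.1 (hzero f hf)⟩
  intro f₀ hf₀
  have hbound : ∀ ε > 0, ‖ψ f₀‖ ≤ ε + 2 * (2 * ε / η) := fun ε hε => by
    obtain ⟨m, ⟨hm1, hm2, w', hw'⟩, hmT⟩ :=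
      exists_cohomContraction_forall_norm_lt hiso hinv hφ (insert f₀ T) ψ hε
    obtain ⟨C, hC1, hC2, hC3, hC4⟩ :=
      exists_contraction_norm_sub_lt A hA (w' - (x - m x)) hε
    set w := w' - (x - m x) with hw
    have hmw : ∀ f ∈ F, ψ f - m (ψ f) = w - π f w := fun f hf => by
      have h := hw' f hf
      simp only [hψ, hw, map_sub, hm2 f hf]
      calc _ = (φ f - m (φ f)) - (x - m x) + (π f x - π f (m x)) := by abel
        _ = _ := by rw [h]; abel
    have hCw : ∀ f ∈ F, ψ f - (C w - π f (C w)) = C (m (ψ f)) := fun f hf => by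
      have hCf : C (π f w) = π f (C w) :=
        congrArg (fun D : X →L[ℝ] X => D w)
          (hC2 (π f) (ContinuousLinearMap.ext fun z => hcomm f hf z)).eq
      have h := congrArg C (hmw f hf)
      rw [C.map_sub (ψ f), C.map_sub w, hC3 _ (hAψ f hf), hCf] at h
      rw [← h]; abel
    have hsmall : ∀ f ∈ F, f ∈ insert f₀ T → ‖ψ f - (C w - π f (C w))‖ ≤ ε := fun f hf hfT => by
      rw [hCw f hf]; exact (hC1 _).trans (hmT f hfT).le
    have hBsmall : ‖C w - B (C w)‖ ≤ ε := by
      have h := norm_average_le T (fun t => ψ t - (C w - π t (C w))) hε.le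
        fun t ht => hsmall t (hTF t ht) (Finset.mem_insert_of_mem ht)
      rwa [Finset.sum_sub_distrib, smul_sub, hψT, hsubB, zero_sub, norm_neg] at h
    have hCwle : ‖C w‖ ≤ 2 * ε / η := by
      rw [le_div_iff₀ hη]
      linarith [hlow (C w), norm_add_le (C w - A (C w)) (C w - B (C w))]
    have h1 := hsmall f₀ hf₀ (Finset.mem_insert_self _ _)
    have h2 := norm_sub_le (C w) (π f₀ (C w))
    rw [hiso] at h2
    linarith [norm_sub_norm_le (ψ f₀) (C w - π f₀ (C w))]
  rw [← norm_le_zero_iff]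
  refine le_of_forall_pos_le_add fun ε hε => ?_
  have hk : 0 < 1 + 4 / η := by positivity
  have h := hbound (ε / (1 + 4 / η)) (by positivity)
  have hrw : ε / (1 + 4 / η) + 2 * (2 * (ε / (1 + 4 / η)) / η) =
      ε / (1 + 4 / η) * (1 + 4 / η) := by
    ring
  rw [hrw, div_mul_cancel₀ _ hk.ne'] at h
  linarith
end
end

section
/- Let G be a group with FC-centre Φ = {g ∈ G : the conjugacy class of g in G is finite}, and let (X,π) be a uniformly convex isometric Banach G-module which, as a Φ-module (by restriction of π), has no almost invariant unit vectors. Then the cochain complex {0} → C⁰(G,X) → C¹(G,X) → C²(G,X) → ⋯ is split exact: for every n ≥ 0, B^n(G,X) = Z^n(G,X) and B^n(G,X) is a complemented subspace of C^n(G,X). -/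
noncomputable section

open scoped BigOperators

variable {G : Type*} [Group G] {X : Type*} [NormedAddCommGroup X] [NormedSpace ℝ X]

/-- The FC-centre `Φ` of `G`: the set of elements with finite conjugacy class. -/
def FCcentre (G : Type*) [Group G] : Set G :=
  {g | Set.Finite {x | ∃ f : G, x = f * g * f⁻¹}}

/-- Almost invariant unit vectors for the restriction of the action to a subset `S ⊆ G`. -/
def HasAIUVOn (π : G →* (X →L[ℝ] X)) (S : Set G) : Prop :=
  ∀ E : Finset G, (E : Set G) ⊆ S → ∀ ε : ℝ, 0 < ε →
    ∃ x : X, ‖x‖ = 1 ∧ ∀ g ∈ E, ‖x - π g x‖ < ε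

/-- The coboundary operator `∂^{n+1} : Cⁿ(G,X) → C^{n+1}(G,X)` of the standard
inhomogeneous cochain complex (with the sign conventions of the paper). -/
def cochainD (π : G →* (X →L[ℝ] X)) (n : ℕ) (φ : (Fin n → G) → X) :
    (Fin (n + 1) → G) → X :=
  fun g =>
    -(π (g 0) (φ fun i => g i.succ)) + ((-1 : ℝ) ^ n) • φ (fun i => g i.castSucc)
      - ∑ k : Fin n, ((-1 : ℝ) ^ ((k : ℕ) + 1)) •
          φ (fun j => if (j : ℕ) < (k : ℕ) then g j.castSucc
            else if (j : ℕ) = (k : ℕ) then g k.castSucc * g k.succ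
            else g j.succ)

/-- The space `Zⁿ(G,X) = ker ∂^{n+1}` of `n`-cocycles. -/
def Zset (π : G →* (X →L[ℝ] X)) (n : ℕ) : Set ((Fin n → G) → X) :=
  {φ | cochainD π n φ = 0}

/-- The space `Bⁿ(G,X) = range ∂ⁿ` of `n`-coboundaries (`B⁰ = {0}`). -/
def Bset (π : G →* (X →L[ℝ] X)) : ∀ n : ℕ, Set ((Fin n → G) → X)
  | 0 => {0}
  | n + 1 => Set.range (cochainD π n)

/-- The cochain complex of `(X,π)` is split exact: for all `n`, `Bⁿ = Zⁿ` and `Bⁿ` is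
the range of a continuous linear projection of `Cⁿ(G,X)`. -/
def SplitExact (π : G →* (X →L[ℝ] X)) : Prop :=
  ∀ n : ℕ, Bset π n = Zset π n ∧
    ∃ P : ((Fin n → G) → X) → ((Fin n → G) → X),
      IsLinearMap ℝ P ∧ Continuous P ∧ P ∘ P = P ∧ Set.range P = Bset π n

set_option linter.unusedSectionVars false

section ListCochains

/-- Multiply the head of a list by `a` on the left before evaluating `F`. -/
def mergeHead (a : G) (F : List G → X) : List G → X
  | [] => F []
  | b :: l => F (a * b :: l)

/-- The bar differential on functions of lists, without its first term. -/
def barTail : (List G → X) → List G → X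
  | _, [] => 0
  | F, a :: l => -mergeHead a F l - barTail (fun m => F (a :: m)) l

/-- The first term of the bar differential on functions of lists. -/
def barHead (π : G →* (X →L[ℝ] X)) (F : List G → X) : List G → X
  | [] => 0
  | a :: l => π a (F l)

/-- The alternating sum over all ways of inserting an element of `S` into a list. -/
def insertSum (S : Finset G) : (List G → X) → List G → X
  | F, [] => ∑ s ∈ S, F [s]
  | F, a :: l => (∑ s ∈ S, F (s :: a :: l)) - insertSum S (fun m => F (a :: m)) l

theorem barTail_add (F H : List G → X) (l : List G) :
    barTail (fun m => F m + H m) l = barTail F l + barTail H l := by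
  induction l generalizing F H with
  | nil => simp [barTail]
  | cons a l ih =>
    simp only [barTail, ih]
    cases l <;> simp only [mergeHead] <;> abel

theorem barTail_neg (F : List G → X) (l : List G) :
    barTail (fun m => -F m) l = -barTail F l := by
  induction l generalizing F with
  | nil => simp [barTail]
  | cons a l ih =>
    simp only [barTail, ih]
    cases l <;> simp only [mergeHead] <;> abel

theorem barTail_sub (F H : List G → X) (l : List G) :
    barTail (fun m => F m - H m) l = barTail F l - barTail H l := by
  simp only [sub_eq_add_neg, barTail_add, barTail_neg]

theorem map_barTail (T : X →L[ℝ] X) (F : List G → X) (l : List G) :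
    barTail (fun m => T (F m)) l = T (barTail F l) := by
  induction l generalizing F with
  | nil => simp [barTail]
  | cons a l ih =>
    simp only [barTail, ih, map_sub, map_neg]
    cases l <;> rfl

theorem barTail_sum {ι : Type*} (S : Finset ι) (F : ι → List G → X) (l : List G) :
    barTail (fun m => ∑ s ∈ S, F s m) l = ∑ s ∈ S, barTail (F s) l := by
  induction l generalizing F with
  | nil => simp [barTail]
  | cons a l ih =>
    simp only [barTail, ih]
    cases l <;> simp [mergeHead]

theorem insertSum_neg_sub (S : Finset G) (F H : List G → X) (l : List G) :
    insertSum S (fun m => -F m - H m) l = -insertSum S F l - insertSum S H l := by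
  induction l generalizing F H with
  | nil => simp [insertSum]
  | cons a l ih =>
    simp only [insertSum, ih, Finset.sum_sub_distrib, Finset.sum_neg_distrib]
    abel

theorem map_insertSum (S : Finset G) (T : X →L[ℝ] X) (F : List G → X) (l : List G) :
    insertSum S (fun m => T (F m)) l = T (insertSum S F l) := by
  induction l generalizing F with
  | nil => simp [insertSum]
  | cons a l ih => simp [insertSum, ih]

/-- Inserting elements is a homotopy for the first term of the bar differential. -/
theorem insertSum_barHead (π : G →* (X →L[ℝ] X)) (S : Finset G) (F : List G → X)
    (l : List G) :
    insertSum S (barHead π F) l + barHead π (insertSum S F) l = ∑ s ∈ S, π s (F l) := by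
  cases l with
  | nil => simp [insertSum, barHead]
  | cons a l => simp [insertSum, barHead, map_insertSum]

theorem sum_mul_comm_of_conj_mem {S : Finset G} (hS : ∀ a, ∀ s ∈ S, a * s * a⁻¹ ∈ S)
    (f : G → X) (a : G) : ∑ s ∈ S, f (s * a) = ∑ s ∈ S, f (a * s) := by
  refine Finset.sum_bij' (fun s _ => a⁻¹ * s * a) (fun s _ => a * s * a⁻¹) ?_ ?_ ?_ ?_ ?_
  · intro s hs
    simpa using hS a⁻¹ s hs
  · exact fun s hs => hS a s hs
  all_goals intro s hs; simp [mul_assoc]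

/-- For a conjugation-invariant set `S`, inserting elements of `S` is a homotopy for the
remaining terms of the bar differential. -/
theorem insertSum_barTail {S : Finset G} (hS : ∀ a, ∀ s ∈ S, a * s * a⁻¹ ∈ S)
    (F : List G → X) (l : List G) :
    insertSum S (barTail F) l + barTail (insertSum S F) l = -∑ _s ∈ S, F l := by
  induction l generalizing F with
  | nil => simp [insertSum, barTail, mergeHead]
  | cons a l ih =>
    have key : -(∑ s ∈ S, F (s * a :: l)) + ∑ s ∈ S, mergeHead a (fun m => F (s :: m)) l
        + insertSum S (mergeHead a F) l - mergeHead a (insertSum S F) l = 0 := by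
      rw [sum_mul_comm_of_conj_mem hS (fun s => F (s :: l)) a]
      cases l with
      | nil => simp [mergeHead, insertSum]
      | cons b l =>
        simp only [mergeHead, insertSum]
        abel
    have h₁ : insertSum S (barTail F) (a :: l)
        = -(∑ s ∈ S, F (s * a :: l)) + ∑ s ∈ S, mergeHead a (fun m => F (s :: m)) l
          + ∑ s ∈ S, barTail (fun m => F (s :: a :: m)) l
          + insertSum S (mergeHead a F) l + insertSum S (barTail fun m => F (a :: m)) l := by
      simp only [insertSum, barTail, insertSum_neg_sub, Finset.sum_sub_distrib,
        Finset.sum_neg_distrib]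
      simp only [mergeHead]
      abel
    have h₂ : barTail (insertSum S F) (a :: l)
        = -mergeHead a (insertSum S F) l - ∑ s ∈ S, barTail (fun m => F (s :: a :: m)) l
          + barTail (insertSum S fun m => F (a :: m)) l := by
      simp only [barTail, insertSum, barTail_sub, barTail_sum]
      abel
    rw [h₁, h₂, ← ih fun m => F (a :: m), ← sub_eq_zero, ← key]
    abel

theorem mergeHead_barTail (a : G) (F : List G → X) (l : List G) :
    mergeHead a (barTail F) l = barTail (mergeHead a F) l := by
  cases l with
  | nil => simp [mergeHead, barTail]
  | cons b l => cases l <;> simp [mergeHead, barTail, mul_assoc]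

theorem barTail_barTail (F : List G → X) (l : List G) : barTail (barTail F) l = 0 := by
  induction l generalizing F with
  | nil => rfl
  | cons a l ih =>
    rw [barTail, mergeHead_barTail]
    simp only [barTail, barTail_sub, barTail_neg, ih]
    abel

/-- The bar differential squares to zero. -/
theorem barHead_add_barTail_sq (π : G →* (X →L[ℝ] X)) (F : List G → X) (l : List G) :
    barHead π (fun m => barHead π F m + barTail F m) l
      + barTail (fun m => barHead π F m + barTail F m) l = 0 := by
  rw [barTail_add, barTail_barTail]
  cases l with
  | nil => simp [barHead, barTail]
  | cons a l =>
    simp only [barHead, barTail, map_barTail, map_add]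
    cases l with
    | nil => simp [barHead, barTail, mergeHead]
    | cons b l =>
      simp only [barHead, mergeHead, map_mul, ContinuousLinearMap.mul_def,
        ContinuousLinearMap.comp_apply]
      abel

theorem barTail_ofFn (F : List G → X) (n : ℕ) (g : Fin (n + 1) → G) :
    barTail F (List.ofFn g)
      = ((-1 : ℝ) ^ (n + 1)) • F (List.ofFn fun i : Fin n => g i.castSucc)
        + ∑ k : Fin n, ((-1 : ℝ) ^ ((k : ℕ) + 1)) •
          F (List.ofFn fun j : Fin n => if (j : ℕ) < (k : ℕ) then g j.castSucc
            else if (j : ℕ) = (k : ℕ) then g k.castSucc * g k.succ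
            else g j.succ) := by
  induction n generalizing F with
  | zero => simp [barTail, mergeHead]
  | succ n ih =>
    rw [List.ofFn_succ, barTail, ih (fun m => F (g 0 :: m)) fun i => g i.succ,
      Fin.sum_univ_succ]
    simp only [List.ofFn_succ, mergeHead, pow_succ _ (n + 1), Fin.val_zero, Fin.val_succ,
      pow_succ _ (_ + 1)]
    simp
    abel

theorem cochainD_ofFn (π : G →* (X →L[ℝ] X)) (n : ℕ) (F : List G → X)
    (g : Fin (n + 1) → G) :
    cochainD π n (fun x => F (List.ofFn x)) g
      = -(barHead π F (List.ofFn g) + barTail F (List.ofFn g)) := by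
  rw [barTail_ofFn, List.ofFn_succ, barHead, cochainD, pow_succ]
  simp only [mul_neg, mul_one, neg_smul]
  abel

end ListCochains

/-- The contracting homotopy `Cⁿ⁺¹(G,X) → Cⁿ(G,X)` before normalization: the alternating
sum over all ways of inserting an element of `S`. -/
def insertCochain (S : Finset G) (n : ℕ) (φ : (Fin (n + 1) → G) → X) : (Fin n → G) → X :=
  fun g => ∑ s ∈ S, ∑ i : Fin (n + 1), ((-1 : ℝ) ^ (i : ℕ)) • φ (i.insertNth s g)

theorem insertCochain_ofFn (S : Finset G) (n : ℕ) (F : List G → X) (g : Fin n → G) :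
    insertCochain S n (fun x => F (List.ofFn x)) g = insertSum S F (List.ofFn g) := by
  induction n generalizing F with
  | zero => simp [insertCochain, insertSum]
  | succ n ih =>
    obtain ⟨a, g, rfl⟩ : ∃ a g', g = Fin.cons a g' := ⟨g 0, Fin.tail g, by simp⟩
    have hc : List.ofFn (Fin.cons a g : Fin (n + 1) → G) = a :: List.ofFn g := by simp
    rw [hc, insertSum, ← ih fun m => F (a :: m)]
    simp only [insertCochain]
    rw [← Finset.sum_sub_distrib]
    refine Finset.sum_congr rfl fun s _ => ?_
    rw [Fin.sum_univ_succ]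
    simp [Fin.insertNth_zero', Fin.insertNth_succ_cons, pow_succ, sub_eq_add_neg]

theorem exists_eq_comp_ofFn (n : ℕ) (φ : (Fin n → G) → X) :
    ∃ F : List G → X, φ = fun x => F (List.ofFn x) :=
  ⟨Function.extend List.ofFn φ 0,
    funext fun x => (List.ofFn_injective.extend_apply φ 0 x).symm⟩

theorem insertCochain_cochainD_zero (π : G →* (X →L[ℝ] X)) (S : Finset G)
    (φ : (Fin 0 → G) → X) (g : Fin 0 → G) :
    insertCochain S 0 (cochainD π 0 φ) g = ∑ s ∈ S, (φ g - π s (φ g)) := by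
  have hg : ∀ x : Fin 0 → G, φ x = φ g := fun x => congrArg φ (Subsingleton.elim _ _)
  simp [insertCochain, cochainD, hg, sub_eq_add_neg, add_comm]

theorem insertCochain_cochainD_succ (π : G →* (X →L[ℝ] X)) {S : Finset G}
    (hS : ∀ a, ∀ s ∈ S, a * s * a⁻¹ ∈ S) (n : ℕ) (φ : (Fin (n + 1) → G) → X)
    (g : Fin (n + 1) → G) :
    insertCochain S (n + 1) (cochainD π (n + 1) φ) g + cochainD π n (insertCochain S n φ) g
      = ∑ s ∈ S, (φ g - π s (φ g)) := by
  obtain ⟨F, rfl⟩ := exists_eq_comp_ofFn (n + 1) φ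
  have h₁ : cochainD π (n + 1) (fun x => F (List.ofFn x))
      = fun x => -barHead π F (List.ofFn x) - barTail F (List.ofFn x) := by
    funext x
    rw [cochainD_ofFn]
    abel
  have h₂ : insertCochain S n (fun x => F (List.ofFn x))
      = fun x => insertSum S F (List.ofFn x) := funext fun x => insertCochain_ofFn S n F x
  rw [h₁, h₂, cochainD_ofFn,
    insertCochain_ofFn S (n + 1) (fun l => -barHead π F l - barTail F l), insertSum_neg_sub,
    Finset.sum_sub_distrib, ← insertSum_barHead π S F, ← neg_neg (∑ s ∈ S, F (List.ofFn g)),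
    ← insertSum_barTail hS F]
  abel

theorem isLinearMap_cochainD (π : G →* (X →L[ℝ] X)) (n : ℕ) :
    IsLinearMap ℝ (cochainD π n) where
  map_add φ ψ := by
    funext g
    simp only [cochainD, Pi.add_apply, map_add, smul_add, Finset.sum_add_distrib]
    abel
  map_smul c φ := by
    funext g
    simp only [cochainD, Pi.smul_apply, map_smul, smul_add, smul_sub, smul_neg,
      Finset.smul_sum, smul_comm c]

theorem continuous_cochainD (π : G →* (X →L[ℝ] X)) (n : ℕ) : Continuous (cochainD π n) := by
  unfold cochainD
  fun_prop

theorem cochainD_map (π : G →* (X →L[ℝ] X)) (T : X →L[ℝ] X)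
    (hT : ∀ g x, T (π g x) = π g (T x)) (n : ℕ) (φ : (Fin n → G) → X) (g : Fin (n + 1) → G) :
    cochainD π n (fun x => T (φ x)) g = T (cochainD π n φ g) := by
  simp [cochainD, hT]

theorem isLinearMap_insertCochain (S : Finset G) (n : ℕ) :
    IsLinearMap ℝ (insertCochain (X := X) S n) where
  map_add φ ψ := by
    funext g
    simp only [insertCochain, Pi.add_apply, smul_add, Finset.sum_add_distrib]
  map_smul c φ := by
    funext g
    simp only [insertCochain, Pi.smul_apply, Finset.smul_sum, smul_comm c]

theorem continuous_insertCochain (S : Finset G) (n : ℕ) :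
    Continuous (insertCochain (X := X) S n) := by
  unfold insertCochain
  fun_prop

theorem cochainD_cochainD (π : G →* (X →L[ℝ] X)) (n : ℕ) (φ : (Fin n → G) → X) :
    cochainD π (n + 1) (cochainD π n φ) = 0 := by
  obtain ⟨F, rfl⟩ := exists_eq_comp_ofFn n φ
  have h : cochainD π n (fun x => F (List.ofFn x))
      = (-1 : ℝ) • fun x => barHead π F (List.ofFn x) + barTail F (List.ofFn x) := by
    funext x
    simp only [cochainD_ofFn, Pi.smul_apply, neg_smul, one_smul]
  funext g
  rw [h, (isLinearMap_cochainD π (n + 1)).map_smul, Pi.smul_apply,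
    cochainD_ofFn π (n + 1) (fun l => barHead π F l + barTail F l), barHead_add_barTail_sq]
  simp

/-- If some finite subset of `Φ` moves all unit vectors by a definite amount, the average of
`π` over a suitable finite conjugation-invariant set is a strict contraction. -/
theorem exists_conj_invariant_average_norm_lt_one [UniformConvexSpace X]
    (π : G →* (X →L[ℝ] X)) (hiso : ∀ (g : G) (x : X), ‖π g x‖ = ‖x‖)
    (hnaiuv : ¬ HasAIUVOn π (FCcentre G)) :
    ∃ S : Finset G, S.Nonempty ∧ (∀ a, ∀ s ∈ S, a * s * a⁻¹ ∈ S) ∧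
      ‖((S.card : ℝ)⁻¹) • ∑ s ∈ S, π s‖ < 1 := by
  classical
  simp only [HasAIUVOn, not_forall, not_exists, not_and, not_lt] at hnaiuv
  obtain ⟨E, hE, ε, hε, h⟩ := hnaiuv
  have hfin : (insert 1 (⋃ g ∈ E, {x | ∃ f : G, x = f * g * f⁻¹})).Finite :=
    (E.finite_toSet.biUnion fun g hg => hE hg).insert 1
  let S : Finset G := hfin.toFinset
  have h1 : (1 : G) ∈ S := by simp [S]
  have hES : ∀ g ∈ E, g ∈ S := by
    intro g hg
    simp only [S, Set.Finite.mem_toFinset, Set.mem_insert_iff, Set.mem_iUnion, Set.mem_ofPred_eq]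
    exact Or.inr ⟨g, hg, 1, by simp⟩
  have hS : ∀ a, ∀ s ∈ S, a * s * a⁻¹ ∈ S := by
    intro a s hs
    simp only [S, Set.Finite.mem_toFinset, Set.mem_insert_iff, Set.mem_iUnion,
      Set.mem_ofPred_eq] at hs ⊢
    rcases hs with rfl | ⟨g, hg, f, rfl⟩
    · simp
    · exact Or.inr ⟨g, hg, a * f, by simp [mul_assoc]⟩
  have hN : (0 : ℝ) < S.card := by exact_mod_cast Finset.card_pos.2 ⟨1, h1⟩
  obtain ⟨δ, hδ, hδ'⟩ := exists_forall_sphere_dist_add_le_two_sub X hε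
  refine ⟨S, ⟨1, h1⟩, hS, lt_of_le_of_lt (ContinuousLinearMap.opNorm_le_of_unit_norm
    (C := max 0 ((S.card : ℝ)⁻¹ * (S.card - δ))) (le_max_left _ _) fun x hx => ?_) ?_⟩
  · refine le_max_of_le_right ?_
    obtain ⟨g, hg, hgx⟩ := h x hx
    have hg1 : g ∈ S.erase 1 := by
      refine Finset.mem_erase.2 ⟨?_, hES g hg⟩
      rintro rfl
      simp at hgx
      linarith
    have hsum : ∑ s ∈ S, π s x = (x + π g x) + ∑ s ∈ (S.erase 1).erase g, π s x := by
      rw [← Finset.add_sum_erase S _ h1, ← Finset.add_sum_erase _ _ hg1]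
      simp [add_assoc]
    have hrest : ‖∑ s ∈ (S.erase 1).erase g, π s x‖ ≤ S.card - 2 := by
      refine (norm_sum_le _ _).trans (le_of_eq ?_)
      have hc₁ := Finset.card_erase_add_one hg1
      have hc₂ := Finset.card_erase_add_one h1
      simp only [hiso, hx, Finset.sum_const, nsmul_eq_mul, mul_one]
      rw [← hc₂, ← hc₁]
      push_cast
      ring
    have hpair := hδ' hx ((hiso g x).trans hx) hgx
    rw [smul_apply, sum_apply, norm_smul, norm_inv,
      Real.norm_of_nonneg hN.le, hsum]
    gcongr
    linarith [norm_add_le (x + π g x) (∑ s ∈ (S.erase 1).erase g, π s x)]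
  · refine max_lt one_pos ?_
    rw [inv_mul_lt_iff₀ hN]
    linarith

/-- A finite conjugation-invariant set `S` together with an equivariant operator inverting
`∑ s ∈ S, (1 - π s)`. -/
theorem exists_equivariant_inverse [CompleteSpace X] [UniformConvexSpace X]
    (π : G →* (X →L[ℝ] X)) (hiso : ∀ (g : G) (x : X), ‖π g x‖ = ‖x‖)
    (hnaiuv : ¬ HasAIUVOn π (FCcentre G)) :
    ∃ (S : Finset G) (T : X →L[ℝ] X), (∀ a, ∀ s ∈ S, a * s * a⁻¹ ∈ S) ∧
      (∀ g x, T (π g x) = π g (T x)) ∧ ∀ x, T (∑ s ∈ S, (x - π s x)) = x := by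
  obtain ⟨S, hne, hS, hA⟩ := exists_conj_invariant_average_norm_lt_one π hiso hnaiuv
  have hN : (S.card : ℝ) ≠ 0 := by exact_mod_cast hne.card_pos.ne'
  set A : X →L[ℝ] X := ((S.card : ℝ)⁻¹) • ∑ s ∈ S, π s with hAdef
  obtain ⟨U, hU⟩ := isUnit_one_sub_of_norm_lt_one hA
  have hcomm : ∀ g, Commute (π g) ↑U⁻¹ := by
    intro g
    refine Commute.units_inv_right ?_
    rw [hU]
    refine (Commute.one_right _).sub_right (Commute.smul_right ?_ _)
    rw [Commute, SemiconjBy, Finset.mul_sum, Finset.sum_mul]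
    simp only [← map_mul]
    exact (sum_mul_comm_of_conj_mem hS π g).symm
  refine ⟨S, ((S.card : ℝ)⁻¹) • ↑U⁻¹, hS, fun g x => ?_, fun x => ?_⟩
  · have := congrArg (fun L : X →L[ℝ] X => L x) (hcomm g).eq
    simp only [mul_apply_eq_comp] at this
    simp [this]
  · have hx : ∑ s ∈ S, (x - π s x) = (S.card : ℝ) • (U : X →L[ℝ] X) x := by
      rw [hU, hAdef]
      simp [smul_sub, smul_smul, hN, Finset.sum_sub_distrib]
      norm_cast
    have hinv := congrArg (fun L : X →L[ℝ] X => L x) U.inv_mul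
    simp only [mul_apply_eq_comp, one_apply_eq_self] at hinv
    rw [hx, smul_apply, map_smul, hinv, smul_smul, inv_mul_cancel₀ hN,
      one_smul]

/-- If `(X,π)` is a uniformly convex isometric Banach `G`-module with no almost
invariant unit vectors as a module over the FC-centre `Φ` of `G`, then the cochain
complex `{0} → C⁰(G,X) → C¹(G,X) → ⋯` is split exact. -/
theorem splitExact_of_no_aiuv_FCcentre [CompleteSpace X] [UniformConvexSpace X]
    (π : G →* (X →L[ℝ] X)) (hiso : ∀ (g : G) (x : X), ‖π g x‖ = ‖x‖)
    (hnaiuv : ¬ HasAIUVOn π (FCcentre G)) :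
    SplitExact π := by
  obtain ⟨S, T, hS, hTπ, hT⟩ := exists_equivariant_inverse π hiso hnaiuv
  let h : ∀ n, ((Fin (n + 1) → G) → X) → (Fin n → G) → X :=
    fun n φ g => T (insertCochain S n φ g)
  have hzero : ∀ φ, h 0 (cochainD π 0 φ) = φ := fun φ => funext fun g => by
    simp only [h]
    rw [insertCochain_cochainD_zero π S φ g, hT]
  have hsucc : ∀ n φ, h (n + 1) (cochainD π (n + 1) φ) + cochainD π n (h n φ) = φ :=
    fun n φ => funext fun g => by
      simp only [h, Pi.add_apply, cochainD_map π T hTπ, ← map_add,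
        insertCochain_cochainD_succ π hS, hT]
  have hlin : ∀ n, IsLinearMap ℝ (h n) := fun n =>
    { map_add := fun φ ψ => funext fun g => by
        simp [h, (isLinearMap_insertCochain S n).map_add]
      map_smul := fun c φ => funext fun g => by
        simp [h, (isLinearMap_insertCochain S n).map_smul] }
  have hcont : ∀ n, Continuous (h n) := fun n => continuous_pi fun g =>
    T.continuous.comp ((continuous_apply g).comp (continuous_insertCochain S n))
  intro n
  cases n with
  | zero =>
    refine ⟨?_, 0, ⟨by simp, by simp⟩, continuous_const, by ext; rfl, by
      ext; simp [Bset]⟩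
    ext φ
    simp only [Bset, Zset, Set.mem_singleton_iff, Set.mem_ofPred_eq]
    refine ⟨?_, fun hφ => ?_⟩
    · rintro rfl
      exact (isLinearMap_cochainD π 0).map_zero
    · rw [← hzero φ, hφ, (hlin 0).map_zero]
  | succ n =>
    have hfix : ∀ φ, cochainD π (n + 1) φ = 0 → cochainD π n (h n φ) = φ := by
      intro φ hφ
      have := hsucc n φ
      rwa [hφ, (hlin (n + 1)).map_zero, zero_add] at this
    refine ⟨?_, fun φ => cochainD π n (h n φ), ?_,
      (continuous_cochainD π n).comp (hcont n), ?_, ?_⟩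
    · refine Set.Subset.antisymm ?_ fun φ hφ => ⟨h n φ, hfix φ hφ⟩
      rintro _ ⟨φ, rfl⟩
      exact cochainD_cochainD π n φ
    · exact ((isLinearMap_cochainD π n).mk' _ ∘ₗ (hlin n).mk' _).isLinear
    · exact funext fun φ => hfix _ (cochainD_cochainD π n _)
    · refine Set.Subset.antisymm ?_ ?_
      · rintro _ ⟨φ, rfl⟩
        exact ⟨_, rfl⟩
      · rintro _ ⟨φ, rfl⟩
        exact ⟨cochainD π n φ, hfix _ (cochainD_cochainD π n φ)⟩
end
end

section
/- Let G be a group with a finite generating set Σ, and let (X,π) be a separable reflexive isometric Banach G-module with X^G = {0}. Then for every cocycle φ ∈ Z¹(G,X) and every ε > 0 there exists x ∈ X such that ‖∑_{g∈Σ} (φ(g) − (x − π(g)x))‖ < ε. -/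
noncomputable section

open scoped BigOperators

variable {G : Type*} [Group G] {X : Type*} [NormedAddCommGroup X] [NormedSpace ℝ X]

open Filter Topology NormedSpace

/-- In a reflexive space, bounded families converge weakly along ultrafilters. -/
theorem exists_weak_limit_of_bounded
    (hrefl : Function.Surjective (inclusionInDoubleDual ℝ X))
    {ι : Type*} (U : Ultrafilter ι) (y : ι → X) (R : ℝ) (hy : ∀ i, ‖y i‖ ≤ R) :
    ∃ m : X, ‖m‖ ≤ R ∧ ∀ f : StrongDual ℝ X, Tendsto (fun i => f (y i)) U (𝓝 (f m)) := by
  have hbd : ∀ (f : StrongDual ℝ X) i, ‖f (y i)‖ ≤ R * ‖f‖ := fun f i => by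
    rw [mul_comm]
    exact (f.le_opNorm _).trans (mul_le_mul_of_nonneg_left (hy i) (norm_nonneg f))
  have hR : 0 ≤ R := by
    obtain ⟨i⟩ := U.neBot.nonempty
    exact (norm_nonneg _).trans (hy i)
  have hex : ∀ f : StrongDual ℝ X, ∃ l : ℝ, Tendsto (fun i => f (y i)) U (𝓝 l) := fun f => by
    have hc := isCompact_closedBall (0 : ℝ) (R * ‖f‖)
    obtain ⟨l, -, hl⟩ := hc.ultrafilter_le_nhds (U.map fun i => f (y i)) (by
      rw [Ultrafilter.coe_map, le_principal_iff]
      exact mem_map.2 (univ_mem' fun i => mem_closedBall_zero_iff.2 (hbd f i)))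
    exact ⟨l, hl⟩
  choose L hL using hex
  have hLbd : ∀ f, ‖L f‖ ≤ R * ‖f‖ := fun f =>
    le_of_tendsto (hL f).norm (Eventually.of_forall (hbd f))
  let Λ : StrongDual ℝ (StrongDual ℝ X) := LinearMap.mkContinuous
    { toFun := L
      map_add' := fun f g => tendsto_nhds_unique (hL (f + g)) ((hL f).add (hL g))
      map_smul' := fun c f => tendsto_nhds_unique (hL (c • f)) ((hL f).const_mul c) } R hLbd
  obtain ⟨m, hm⟩ := hrefl Λ
  have hmL : ∀ f, f m = L f := fun f => by
    rw [← dual_def ℝ X m f, hm]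
    rfl
  refine ⟨m, norm_le_dual_bound ℝ m hR fun f => ?_, fun f => ?_⟩
  · rw [hmL]
    exact hLbd f
  · rw [hmL]
    exact hL f

/-- A contraction of a reflexive space has a fixed point in every closed hyperplane that is the
level set of an invariant functional. -/
theorem exists_fixed_point_of_invariant_functional
    (hrefl : Function.Surjective (inclusionInDoubleDual ℝ X))
    (P : X →L[ℝ] X) (hP : ∀ x, ‖P x‖ ≤ ‖x‖)
    (f : StrongDual ℝ X) (hf : ∀ x, f (P x) = f x) (v : X) :
    ∃ m, P m = m ∧ f m = f v := by
  have hit : ∀ k, ‖P^[k] v‖ ≤ ‖v‖ := fun k => by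
    induction k with
    | zero => simp
    | succ k ih =>
      rw [Function.iterate_succ_apply']
      exact (hP _).trans ih
  have hfit : ∀ k, f (P^[k] v) = f v := fun k => by
    induction k with
    | zero => simp
    | succ k ih => rw [Function.iterate_succ_apply', hf, ih]
  let y : ℕ → X := fun n => ((n : ℝ) + 1)⁻¹ • ∑ k ∈ Finset.range (n + 1), P^[k] v
  have hyd : ∀ n, y n = ((n : ℝ) + 1)⁻¹ • ∑ k ∈ Finset.range (n + 1), P^[k] v := fun n => rfl
  have hpos : ∀ n : ℕ, (0 : ℝ) < (n : ℝ) + 1 := fun n => by positivity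
  have hyn : ∀ n, ‖y n‖ ≤ ‖v‖ := fun n => by
    rw [hyd, norm_smul, norm_inv, Real.norm_of_nonneg (hpos n).le,
      inv_mul_le_iff₀ (hpos n)]
    refine (norm_sum_le_of_le _ fun k _ => hit k).trans ?_
    simp
  have hfy : ∀ n, f (y n) = f v := fun n => by
    rw [hyd, map_smul, map_sum, Finset.sum_congr rfl fun k _ => hfit k]
    have := (hpos n).ne'
    simp
    field_simp
  have hPy : Tendsto (fun n => P (y n) - y n) atTop (𝓝 0) := by
    have hb : ∀ n, ‖P (y n) - y n‖ ≤ 2 * ‖v‖ * (1 / ((n : ℝ) + 1)) := fun n => by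
      have : P (y n) - y n = ((n : ℝ) + 1)⁻¹ • (P^[n + 1] v - v) := by
        rw [hyd, map_smul, map_sum, ← smul_sub, ← Finset.sum_sub_distrib]
        simp_rw [← Function.iterate_succ_apply']
        rw [Finset.sum_range_sub (fun k => P^[k] v)]
        simp
      rw [this, norm_smul, norm_inv, Real.norm_of_nonneg (hpos n).le, one_div, mul_comm]
      refine mul_le_mul_of_nonneg_right ?_ (inv_nonneg.2 (hpos n).le)
      linarith [norm_sub_le (P^[n + 1] v) v, hit (n + 1)]
    refine squeeze_zero_norm hb ?_
    simpa using (tendsto_one_div_add_atTop_nhds_zero_nat (𝕜 := ℝ)).const_mul (2 * ‖v‖)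
  let U : Ultrafilter ℕ := Ultrafilter.of atTop
  have hU : (U : Filter ℕ) ≤ atTop := Ultrafilter.of_le atTop
  obtain ⟨m, -, hm⟩ := exists_weak_limit_of_bounded hrefl U y ‖v‖ hyn
  refine ⟨m, ?_, ?_⟩
  · refine (SeparatingDual.eq_iff_forall_dual_eq (R := ℝ)).2 fun φ => ?_
    have h1 := hm (φ.comp P)
    have h2 : Tendsto (fun n => φ (P (y n) - y n)) U (𝓝 0) := by
      rw [← map_zero φ]
      exact (φ.continuous.tendsto 0).comp (hPy.mono_left hU)
    refine tendsto_nhds_unique h1 ?_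
    simpa using h2.add (hm φ)
  · refine tendsto_nhds_unique (hm f) ?_
    simp only [hfy]
    exact tendsto_const_nhds

/-- Bounded families in a separable reflexive space are dentable: some slice is contained in a
small ball. -/
theorem exists_slice_subset_ball [TopologicalSpace.SeparableSpace X]
    (hrefl : Function.Surjective (inclusionInDoubleDual ℝ X))
    {ι : Type*} [Nonempty ι] (y : ι → X) (R : ℝ) (hy : ∀ i, ‖y i‖ ≤ R) {δ : ℝ} (hδ : 0 < δ) :
    ∃ (f : StrongDual ℝ X) (c : ℝ) (z : X),
      (∃ i, c < f (y i)) ∧ ∀ i, c < f (y i) → ‖y i - z‖ ≤ 2 * δ := by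
  let U : Ultrafilter ℕ := Ultrafilter.of atTop
  have hU : (U : Filter ℕ) ≤ atTop := Ultrafilter.of_le atTop
  have hbdd : ∀ f : StrongDual ℝ X, BddAbove (Set.range fun i => f (y i)) := fun f => by
    refine ⟨‖f‖ * R, ?_⟩
    rintro _ ⟨i, rfl⟩
    exact (le_abs_self _).trans
      ((f.le_opNorm _).trans (mul_le_mul_of_nonneg_left (hy i) (norm_nonneg f)))
  let K : Set X := {m | ∀ (φ : StrongDual ℝ X) (c : ℝ), (∀ i, φ (y i) ≤ c) → φ m ≤ c}
  let d : ℕ → X := TopologicalSpace.denseSeq X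
  let F : ℕ → Set (StrongDual ℝ X) := fun k =>
    {f | ∃ m ∈ K, ‖m - d k‖ ≤ δ ∧ ∀ i, f (y i) ≤ f m}
  have hclosed : ∀ k, IsClosed (F k) := fun k => by
    refine IsSeqClosed.isClosed fun u f hu huf => ?_
    choose m hmK hmd hmax using hu
    obtain ⟨w, hw, hlim⟩ := exists_weak_limit_of_bounded hrefl U (fun n => m n - d k) δ hmd
    have hlim' : ∀ φ : StrongDual ℝ X, Tendsto (fun n => φ (m n)) U (𝓝 (φ (w + d k))) :=
      fun φ => by simpa using (hlim φ).add_const (φ (d k))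
    refine ⟨w + d k, fun φ c hc => ?_, by simpa using hw, fun i => ?_⟩
    · exact le_of_tendsto (hlim' φ) (Eventually.of_forall fun n => hmK n φ c hc)
    · have h1 : Tendsto (fun n => u n (y i)) U (𝓝 (f (y i))) :=
        ((((ContinuousLinearMap.apply ℝ ℝ (y i)).continuous.tendsto f).comp huf).mono_left hU)
      have h0 : Tendsto (fun n => ‖u n - f‖ * (δ + ‖d k‖)) U (𝓝 0) := by
        simpa using ((tendsto_iff_norm_sub_tendsto_zero.1 huf).mono_left hU).mul_const
          (δ + ‖d k‖)
      have h2 : Tendsto (fun n => (u n - f) (m n)) U (𝓝 0) := by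
        refine squeeze_zero_norm (fun n => ?_) h0
        refine ((u n - f).le_opNorm _).trans (mul_le_mul_of_nonneg_left ?_ (norm_nonneg _))
        have := norm_add_le (m n - d k) (d k)
        rw [sub_add_cancel] at this
        linarith [hmd n]
      have h3 : Tendsto (fun n => u n (m n)) U (𝓝 (f (w + d k))) := by
        simpa using h2.add (hlim' f)
      exact le_of_tendsto_of_tendsto' h1 h3 fun n => hmax n i
  have hcover : ⋃ k, F k = Set.univ := by
    refine Set.eq_univ_of_forall fun f => ?_
    have hseq : ∀ n : ℕ, ∃ i, (⨆ i, f (y i)) - 1 / ((n : ℝ) + 1) < f (y i) := fun n =>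
      exists_lt_of_lt_ciSup (sub_lt_self _ Nat.one_div_pos_of_nat)
    choose j hj using hseq
    obtain ⟨m, -, hm⟩ := exists_weak_limit_of_bounded hrefl U (fun n => y (j n)) R fun n => hy _
    have hsup : (⨆ i, f (y i)) ≤ f m := by
      have h0 : Tendsto (fun n : ℕ => (⨆ i, f (y i)) - 1 / ((n : ℝ) + 1)) U
          (𝓝 ((⨆ i, f (y i)) - 0)) :=
        ((tendsto_one_div_add_atTop_nhds_zero_nat (𝕜 := ℝ)).mono_left hU).const_sub _
      rw [sub_zero] at h0
      exact le_of_tendsto_of_tendsto' h0 (hm f) fun n => (hj n).le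
    obtain ⟨_, hk, k, rfl⟩ := Metric.dense_iff.1 (TopologicalSpace.denseRange_denseSeq X) m δ hδ
    refine Set.mem_iUnion.2 ⟨k, m, fun φ c hc => ?_, ?_, fun i => (le_ciSup (hbdd f) i).trans hsup⟩
    · exact le_of_tendsto (hm φ) (Eventually.of_forall fun n => hc _)
    · rw [← dist_eq_norm, dist_comm]
      exact (Metric.mem_ball.1 hk).le
  obtain ⟨k, f, hfint⟩ := nonempty_interior_of_iUnion_of_closed hclosed hcover
  obtain ⟨r, hr, hball⟩ := Metric.isOpen_iff.1 isOpen_interior f hfint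
  refine ⟨f, (⨆ i, f (y i)) - r / 2 * δ, d k,
    exists_lt_of_lt_ciSup (sub_lt_self _ (by positivity)), fun i hi => ?_⟩
  by_contra! hlt
  obtain ⟨g, hg1, hg⟩ := exists_dual_vector'' ℝ (y i - d k)
  have hmem : f + (r / 2) • g ∈ F k := by
    refine interior_subset (hball ?_)
    rw [Metric.mem_ball, dist_eq_norm, add_sub_cancel_left, norm_smul,
      Real.norm_of_nonneg (by positivity)]
    nlinarith
  obtain ⟨m, hmK, hmd, hmax⟩ := hmem
  have h1 := hmax i
  have h2 : f m ≤ ⨆ i, f (y i) := hmK f _ fun i => le_ciSup (hbdd f) i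
  have h3 : g (m - d k) ≤ δ :=
    (le_abs_self _).trans ((g.le_opNorm _).trans (by
      nlinarith [norm_nonneg (m - d k)]))
  simp only [add_apply, smul_apply, smul_eq_mul] at h1
  simp only [map_sub, RCLike.ofReal_real_eq_id, id_eq] at hg h3
  nlinarith [mul_lt_mul_of_pos_left hlt (half_pos hr), mul_le_mul_of_nonneg_left h3 (half_pos hr).le]

/-- Harmonic vectors of isometric actions on separable reflexive spaces are invariant. -/
theorem apply_eq_of_sum_sub_eq_zero [TopologicalSpace.SeparableSpace X]
    (hrefl : Function.Surjective (inclusionInDoubleDual ℝ X))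
    (π : G →* (X →L[ℝ] X)) (hiso : ∀ (g : G) (x : X), ‖π g x‖ = ‖x‖)
    (S : Finset G) (x : X) (hx : ∑ g ∈ S, (x - π g x) = 0) :
    ∀ g ∈ S, π g x = x := by
  classical
  by_contra! hne
  obtain ⟨g₀, hg₀, hne₀⟩ := hne
  let T : Finset G := S.filter fun g => x - π g x ≠ 0
  have hT : T.Nonempty := ⟨g₀, Finset.mem_filter.2 ⟨hg₀, sub_ne_zero.2 hne₀.symm⟩⟩
  have hTsum : ∑ g ∈ T, (x - π g x) = 0 := by
    rw [← hx]
    exact Finset.sum_filter_ne_zero S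
  obtain ⟨g₁, hg₁, hmin⟩ := T.exists_min_image (fun g => ‖x - π g x‖) hT
  have hδ : 0 < ‖x - π g₁ x‖ / 8 := by
    have := norm_pos_iff.2 (Finset.mem_filter.1 hg₁).2
    positivity
  obtain ⟨f, c, z, ⟨h, hh⟩, hsl⟩ := exists_slice_subset_ball hrefl (fun h : G => π h x) ‖x‖
    (fun h => (hiso h x).le) hδ
  have hsum : ∑ g ∈ T, (f (π h x) - f (π (h * g) x)) ≤ ∑ g ∈ T, (0 : ℝ) := by
    have := congrArg (fun w => f (π h w)) hTsum
    simp only [map_sum, map_sub, map_zero] at this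
    simpa using this.le
  obtain ⟨g, hgT, hg⟩ := Finset.exists_le_of_sum_le hT hsum
  have h1 := hsl h hh
  have h2 := hsl (h * g) (by linarith)
  have h3 : ‖x - π g x‖ = ‖π h x - π (h * g) x‖ := by
    rw [← hiso h, map_sub, map_mul]
    rfl
  have h4 := norm_sub_le (π h x - z) (π (h * g) x - z)
  rw [sub_sub_sub_cancel_right] at h4
  linarith [hmin g hgT]

/-- If `G` is generated by a finite set `Σ` and `(X,π)` is a separable reflexive
isometric Banach `G`-module with `X^G = {0}`, then for every cocycle `φ ∈ Z¹(G,X)` and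
`ε > 0` there is `x ∈ X` with `‖∑_{g ∈ Σ} (φ − ∂x)(g)‖ < ε`. -/
theorem sum_over_generators_almost_coboundary
    [CompleteSpace X] [TopologicalSpace.SeparableSpace X]
    (hrefl : Function.Surjective (NormedSpace.inclusionInDoubleDual ℝ X))
    (π : G →* (X →L[ℝ] X)) (hiso : ∀ (g : G) (x : X), ‖π g x‖ = ‖x‖)
    (Sgen : Finset G) (hgen : Subgroup.closure (Sgen : Set G) = ⊤)
    (hinv : ∀ x : X, (∀ g : G, π g x = x) → x = 0) :
    ∀ (φ : G → X), IsCocycle π φ → ∀ ε : ℝ, 0 < ε →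
      ∃ x : X, ‖∑ g ∈ Sgen, (φ g - (x - π g x))‖ < ε := by
  intro φ _ ε hε
  set v : X := ∑ g ∈ Sgen, φ g with hv
  let A : X →L[ℝ] X := ∑ g ∈ Sgen, (ContinuousLinearMap.id ℝ X - π g)
  have hA : ∀ x, A x = ∑ g ∈ Sgen, (x - π g x) := fun x => by
    simp [A]
  let V : Submodule ℝ X := A.range.topologicalClosure
  suffices hmem : v ∈ V by
    obtain ⟨_, ⟨x, rfl⟩, hx⟩ := Metric.mem_closure_iff.1 hmem ε hε
    refine ⟨x, ?_⟩
    rw [Finset.sum_sub_distrib, ← hA, ← dist_eq_norm]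
    exact hx
  by_contra hvV
  obtain ⟨f, u, hfu, hu⟩ := geometric_hahn_banach_closed_point V.convex
    A.range.isClosed_topologicalClosure hvV
  have hfA : ∀ x, f (A x) = 0 := fun x => by
    by_contra hne
    have := hfu (A ((u / f (A x)) • x)) (subset_closure ⟨_, rfl⟩)
    rw [map_smul, map_smul, smul_eq_mul, div_mul_cancel₀ _ hne] at this
    exact this.false
  have hfv : f v ≠ 0 := by
    have := hfu 0 V.zero_mem
    rw [map_zero] at this
    exact (this.trans hu).ne'
  have hS : 0 < (Sgen.card : ℝ) := by
    rw [Nat.cast_pos, Finset.card_pos, Finset.nonempty_iff_ne_empty]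
    rintro rfl
    exact hfv (by simp [hv])
  let P : X →L[ℝ] X := (Sgen.card : ℝ)⁻¹ • ∑ g ∈ Sgen, π g
  have hPA : ∀ x, x - P x = (Sgen.card : ℝ)⁻¹ • A x := fun x => by
    rw [hA, Finset.sum_sub_distrib, smul_sub, Finset.sum_const, ← Nat.cast_smul_eq_nsmul ℝ,
      inv_smul_smul₀ hS.ne']
    simp [P]
  have hP : ∀ x, ‖P x‖ ≤ ‖x‖ := fun x => by
    simp only [P, smul_apply, sum_apply]
    rw [norm_smul, norm_inv, Real.norm_of_nonneg hS.le, inv_mul_le_iff₀ hS]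
    refine (norm_sum_le_of_le _ fun g _ => (hiso g x).le).trans ?_
    simp
  have hfP : ∀ x, f (P x) = f x := fun x => by
    have := congrArg f (hPA x)
    rw [map_sub, map_smul, hfA, smul_zero, sub_eq_zero] at this
    exact this.symm
  obtain ⟨m, hPm, hfm⟩ := exists_fixed_point_of_invariant_functional hrefl P hP f hfP v
  have hAm : ∑ g ∈ Sgen, (m - π g m) = 0 := by
    have := hPA m
    rw [hPm, sub_self] at this
    rw [← hA]
    exact (smul_eq_zero.1 this.symm).resolve_left (inv_ne_zero hS.ne')
  have hfix := apply_eq_of_sum_sub_eq_zero hrefl π hiso Sgen m hAm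
  have hm0 : m = 0 := hinv m fun g => by
    have hg : g ∈ Subgroup.closure (Sgen : Set G) := hgen ▸ Subgroup.mem_top g
    induction hg using Subgroup.closure_induction with
    | mem g hg => exact hfix g hg
    | one => simp
    | mul a b _ _ ha hb => rw [map_mul, mul_apply_eq_comp, hb, ha]
    | inv a _ ha =>
      nth_rewrite 1 [← ha]
      rw [← mul_apply_eq_comp, ← map_mul, inv_mul_cancel, map_one]
      rfl
  exact hfv (by rw [← hfm, hm0, map_zero])
end
end

section
/- Let G be a group and (X,π) an isometric Banach G-module; let X/X^G carry the quotient norm and the induced isometric action π̄(g)(x + X^G) = π(g)x + X^G. Then for every g ∈ G and x ∈ X: (1/2)·‖x − π(g)x‖ ≤ ‖x̄ − π̄(g)x̄‖_{X/X^G} ≤ ‖x − π(g)x‖, where x̄ = x + X^G. Moreover, if φ ∈ Z¹(G,X) satisfies lim_{n→∞} φ(gⁿ)/n = 0, then (1/2)·‖φ(g)‖ ≤ ‖φ(g) + X^G‖_{X/X^G} ≤ ‖φ(g)‖. -/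
noncomputable section

open scoped BigOperators

variable {G : Type*} [Group G] {X : Type*} [NormedAddCommGroup X] [NormedSpace ℝ X]

/-- The submodule `X^G` of `G`-invariant vectors. -/
def invariants (π : G →* (X →L[ℝ] X)) : Submodule ℝ X where
  carrier := {x | ∀ g : G, π g x = x}
  add_mem' := by
    intro a b ha hb g
    simp [map_add, ha g, hb g]
  zero_mem' := by
    intro g
    simp
  smul_mem' := by
    intro c x hx g
    simp [map_smul, hx g]

/-- The induced action `π̄` of `G` on the quotient `X / X^G`,
`π̄(g)(x + X^G) = π(g)x + X^G`. -/
def pibar (π : G →* (X →L[ℝ] X)) (g : G) :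
    (X ⧸ invariants π) →ₗ[ℝ] (X ⧸ invariants π) :=
  Submodule.mapQ (invariants π) (invariants π) (π g).toLinearMap
    (by
      intro x hx
      intro h
      show π h (π g x) = π g x
      rw [hx g, hx h])

/-- The displacement of a vector is a coboundary, hence a cocycle. -/
theorem isCocycle_sub_apply (π : G →* (X →L[ℝ] X)) (x : X) :
    IsCocycle π fun g => x - π g x := by
  intro g f
  simp

/-- Invariant vectors can be pulled out of the partial orbit sums `φ(gⁿ)` of a cocycle. -/
theorem norm_cocycle_pow_add_nsmul_le (π : G →* (X →L[ℝ] X))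
    (hiso : ∀ (g : G) (x : X), ‖π g x‖ = ‖x‖) {φ : G → X} (hφ : IsCocycle π φ) (g : G)
    {z : X} (hz : z ∈ invariants π) (n : ℕ) :
    ‖φ (g ^ n) + n • z‖ ≤ n * ‖φ g + z‖ := by
  induction n with
  | zero =>
    have h1 : φ 1 = 0 := by simpa using hφ 1 1
    simp [h1]
  | succ n ih =>
    have hsplit : φ (g ^ (n + 1)) + (n + 1) • z = π g (φ (g ^ n) + n • z) + (φ g + z) := by
      rw [pow_succ', hφ, map_add, map_nsmul, hz g, succ_nsmul]
      abel
    calc ‖φ (g ^ (n + 1)) + (n + 1) • z‖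
        ≤ ‖π g (φ (g ^ n) + n • z)‖ + ‖φ g + z‖ := hsplit ▸ norm_add_le _ _
      _ ≤ n * ‖φ g + z‖ + ‖φ g + z‖ := by rw [hiso]; gcongr
      _ = (n + 1 : ℕ) * ‖φ g + z‖ := by push_cast; ring

theorem norm_invariant_le_norm_cocycle_add (π : G →* (X →L[ℝ] X))
    (hiso : ∀ (g : G) (x : X), ‖π g x‖ = ‖x‖) {φ : G → X} (hφ : IsCocycle π φ) (g : G)
    (hlim : Filter.Tendsto (fun n : ℕ => (n : ℝ)⁻¹ • φ (g ^ n)) Filter.atTop (nhds 0))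
    {z : X} (hz : z ∈ invariants π) : ‖z‖ ≤ ‖φ g + z‖ := by
  have hlim' : Filter.Tendsto (fun n : ℕ => ‖(n : ℝ)⁻¹ • φ (g ^ n) + z‖) Filter.atTop
      (nhds ‖z‖) := by
    simpa using (hlim.add_const z).norm
  refine le_of_tendsto hlim' ?_
  filter_upwards [Filter.eventually_gt_atTop 0] with n hn
  have hn' : (0 : ℝ) < n := Nat.cast_pos.mpr hn
  have heq : (n : ℝ)⁻¹ • φ (g ^ n) + z = (n : ℝ)⁻¹ • (φ (g ^ n) + n • z) := by
    rw [smul_add, ← Nat.cast_smul_eq_nsmul ℝ, inv_smul_smul₀ hn'.ne']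
  rw [heq, norm_smul, norm_inv, Real.norm_natCast, inv_mul_le_iff₀ hn']
  exact norm_cocycle_pow_add_nsmul_le π hiso hφ g hz n

theorem tendsto_inv_smul_sub_apply_pow (π : G →* (X →L[ℝ] X))
    (hiso : ∀ (g : G) (x : X), ‖π g x‖ = ‖x‖) (g : G) (x : X) :
    Filter.Tendsto (fun n : ℕ => (n : ℝ)⁻¹ • (x - π (g ^ n) x)) Filter.atTop (nhds 0) := by
  refine squeeze_zero_norm (a := fun n : ℕ => (n : ℝ)⁻¹ * (2 * ‖x‖)) (fun n => ?_) ?_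
  · rw [norm_smul, norm_inv, Real.norm_natCast]
    gcongr
    calc ‖x - π (g ^ n) x‖ ≤ ‖x‖ + ‖π (g ^ n) x‖ := norm_sub_le _ _
      _ = 2 * ‖x‖ := by rw [hiso]; ring
  · simpa using (tendsto_inv_atTop_nhds_zero_nat (𝕜 := ℝ)).mul_const (2 * ‖x‖)

/-- If `φ(gⁿ)/n → 0`, passing to the quotient by `X^G` shrinks `φ(g)` by at most a factor `2`. -/
theorem norm_mk_cocycle_bounds (π : G →* (X →L[ℝ] X)) (hiso : ∀ (g : G) (x : X), ‖π g x‖ = ‖x‖)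
    {φ : G → X} (hφ : IsCocycle π φ) (g : G)
    (hlim : Filter.Tendsto (fun n : ℕ => (n : ℝ)⁻¹ • φ (g ^ n)) Filter.atTop (nhds 0)) :
    (1 / 2 : ℝ) * ‖φ g‖ ≤ ‖(Submodule.Quotient.mk (φ g) : X ⧸ invariants π)‖ ∧
      ‖(Submodule.Quotient.mk (φ g) : X ⧸ invariants π)‖ ≤ ‖φ g‖ := by
  refine ⟨le_of_forall_pos_le_add fun ε hε => ?_, Submodule.Quotient.norm_mk_le _ _⟩
  obtain ⟨m, hm, hlt⟩ := Submodule.Quotient.norm_mk_lt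
    (Submodule.Quotient.mk (φ g) : X ⧸ invariants π) hε
  obtain ⟨z, hz, rfl⟩ : ∃ z ∈ invariants π, m = φ g + z :=
    ⟨m - φ g, (Submodule.Quotient.eq _).mp hm, by abel⟩
  have hnorm := norm_invariant_le_norm_cocycle_add π hiso hφ g hlim hz
  have htri : ‖φ g‖ ≤ ‖φ g + z‖ + ‖z‖ := by
    simpa using norm_sub_le (φ g + z) z
  linarith

/-- For an isometric Banach `G`-module `(X,π)` and the quotient module `X/X^G` with its
quotient norm and induced action `π̄`: `(1/2)·‖x − π(g)x‖ ≤ ‖x̄ − π̄(g)x̄‖ ≤ ‖x − π(g)x‖`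
for all `g ∈ G`, `x ∈ X`; moreover if `φ ∈ Z¹(G,X)` satisfies `φ(gⁿ)/n → 0`, then
`(1/2)·‖φ(g)‖ ≤ ‖φ(g) + X^G‖ ≤ ‖φ(g)‖`. -/
theorem quotient_displacement [CompleteSpace X]
    (π : G →* (X →L[ℝ] X)) (hiso : ∀ (g : G) (x : X), ‖π g x‖ = ‖x‖) :
    (∀ (g : G) (x : X),
      (1 / 2 : ℝ) * ‖x - π g x‖ ≤
          ‖(Submodule.Quotient.mk x : X ⧸ invariants π) - pibar π g (Submodule.Quotient.mk x)‖ ∧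
      ‖(Submodule.Quotient.mk x : X ⧸ invariants π) - pibar π g (Submodule.Quotient.mk x)‖ ≤
          ‖x - π g x‖) ∧
    (∀ (φ : G → X), IsCocycle π φ → ∀ g : G,
      Filter.Tendsto (fun n : ℕ => (n : ℝ)⁻¹ • φ (g ^ n)) Filter.atTop (nhds 0) →
      (1 / 2 : ℝ) * ‖φ g‖ ≤ ‖(Submodule.Quotient.mk (φ g) : X ⧸ invariants π)‖ ∧
        ‖(Submodule.Quotient.mk (φ g) : X ⧸ invariants π)‖ ≤ ‖φ g‖) := by
  exact ⟨fun g x => norm_mk_cocycle_bounds π hiso (isCocycle_sub_apply π x) g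
      (tendsto_inv_smul_sub_apply_pow π hiso g x),
    fun φ hφ g hlim => norm_mk_cocycle_bounds π hiso hφ g hlim⟩
end
end

section
/- Let G be a group admitting no non-trivial group homomorphism to the additive group ℝ, and let (X,π) be an isometric Banach G-module, with induced isometric module (X/X^G, π̄) on the quotient. Then: (1) if H¹(G, X/X^G) = {0}, then H¹(G,X) = {0}; and (2) if H̄¹(G, X/X^G) = {0}, then H̄¹(G,X) = {0}. -/
noncomputable section

open scoped BigOperators

variable {G : Type*} [Group G] {X : Type*} [NormedAddCommGroup X] [NormedSpace ℝ X]

/-- The coboundary `∂¹x = (g ↦ x - π(g)x)`; `B¹(G,X)` is the range of this map. -/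
def cob1 (π : G →* (X →L[ℝ] X)) (x : X) : G → X := fun g => x - π g x

/-- A group without non-trivial additive real characters has no non-trivial additive maps
into any real vector space. -/
theorem additive_map_eq_zero {V : Type*} [AddCommGroup V] [Module ℝ V]
    (hhom : ∀ c : G → ℝ, (∀ a b : G, c (a * b) = c a + c b) → c = 0)
    (c : G → V) (hc : ∀ a b : G, c (a * b) = c a + c b) (g : G) : c g = 0 := by
  rw [← Module.forall_dual_apply_eq_zero_iff ℝ]
  intro f
  exact congrFun (hhom (fun g => f (c g)) fun a b => by simp [hc]) g

/-- The asymptotic version of `additive_map_eq_zero`: a family of maps that is pointwise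
asymptotically additive along a filter tends to zero pointwise. -/
theorem tendsto_zero_of_asymptotically_additive {ι : Type*} (l : Filter ι)
    (hhom : ∀ c : G → ℝ, (∀ a b : G, c (a * b) = c a + c b) → c = 0)
    (c : G → ι → X)
    (hc : ∀ a b : G, Filter.Tendsto (c (a * b) - (c a + c b)) l (nhds 0)) (g : G) :
    Filter.Tendsto (c g) l (nhds 0) := by
  let N : Submodule ℝ (ι → X) :=
    { carrier := {f | Filter.Tendsto f l (nhds 0)}
      add_mem' := fun {f h} hf hh => by
        simpa only [Set.mem_ofPred_eq, add_zero] using! Filter.Tendsto.add hf hh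
      zero_mem' := tendsto_const_nhds
      smul_mem' := fun r f hf => by
        simpa only [Set.mem_ofPred_eq, smul_zero] using! Filter.Tendsto.const_smul hf r }
  refine (Submodule.Quotient.mk_eq_zero N).1
    (additive_map_eq_zero hhom (fun g => Submodule.Quotient.mk (p := N) (c g)) ?_ g)
  intro a b
  rw [← Submodule.Quotient.mk_add]
  exact (Submodule.Quotient.eq N).2 (hc a b)

/-- If a family of vectors tends to zero modulo the invariants, each group element moves it by
an amount tending to zero. -/
theorem tendsto_action_sub_self {ι : Type*} {l : Filter ι} (π : G →* (X →L[ℝ] X)) {u : ι → X}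
    (hu : Filter.Tendsto (fun i => (invariants π).mkQ (u i)) l (nhds 0)) (a : G) :
    Filter.Tendsto (fun i => π a (u i) - u i) l (nhds 0) := by
  let T : X →L[ℝ] X := π a - ContinuousLinearMap.id ℝ X
  let S := (invariants π).liftQ T.toLinearMap fun x hx => sub_eq_zero.2 (hx a)
  have hS : Continuous S :=
    (invariants π).isOpenQuotientMap_mkQ.isQuotientMap.continuous_iff.2 T.continuous
  exact (hS.tendsto' 0 0 (map_zero S)).comp hu

/-- The defect of additivity of the difference of a cocycle and a coboundary. -/
theorem IsCocycle.sub_cob1_mul {π : G →* (X →L[ℝ] X)} {φ : G → X} (hφ : IsCocycle π φ)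
    (x : X) (a b : G) :
    φ (a * b) - cob1 π x (a * b) - ((φ a - cob1 π x a) + (φ b - cob1 π x b)) =
      π a (φ b - cob1 π x b) - (φ b - cob1 π x b) := by
  have hmul : π (a * b) x = π a (π b x) := by rw [map_mul]; rfl
  simp only [hφ a b, cob1, hmul, map_sub]
  abel

/-- The projection of a cocycle to the quotient module is a cocycle. -/
theorem IsCocycle.mkQ_mul {π : G →* (X →L[ℝ] X)} {φ : G → X} (hφ : IsCocycle π φ) (a b : G) :
    (invariants π).mkQ (φ (a * b)) =
      pibar π a ((invariants π).mkQ (φ b)) + (invariants π).mkQ (φ a) := by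
  rw [hφ a b, map_add]
  rfl

/-- The projection of a coboundary to the quotient module. -/
theorem mkQ_cob1 (π : G →* (X →L[ℝ] X)) (x : X) (g : G) :
    (invariants π).mkQ (cob1 π x g) =
      (invariants π).mkQ x - pibar π g ((invariants π).mkQ x) :=
  map_sub _ _ _

/-- Let `G` be a group with no non-trivial homomorphism to the additive reals and
`(X,π)` an isometric Banach `G`-module. Then (1) vanishing of `H¹(G, X/X^G)` implies
vanishing of `H¹(G,X)`, and (2) vanishing of the reduced cohomology `H̄¹(G, X/X^G)`
implies vanishing of `H̄¹(G,X)` (closures taken in the topology of pointwise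
convergence). -/
theorem H1_of_quotient_H1 [CompleteSpace X]
    (hhom : ∀ c : G → ℝ, (∀ a b : G, c (a * b) = c a + c b) → c = 0)
    (π : G →* (X →L[ℝ] X)) (hiso : ∀ (g : G) (x : X), ‖π g x‖ = ‖x‖) :
    ((∀ ψ : G → X ⧸ invariants π,
        (∀ a b : G, ψ (a * b) = pibar π a (ψ b) + ψ a) →
        ∃ v : X ⧸ invariants π, ψ = fun g => v - pibar π g v) →
      (∀ φ : G → X, IsCocycle π φ → ∃ x : X, φ = cob1 π x)) ∧
    ((∀ ψ : G → X ⧸ invariants π,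
        (∀ a b : G, ψ (a * b) = pibar π a (ψ b) + ψ a) →
        ψ ∈ closure (Set.range fun v : X ⧸ invariants π => fun g => v - pibar π g v)) →
      (∀ φ : G → X, IsCocycle π φ → φ ∈ closure (Set.range (cob1 π)))) := by
  constructor
  · intro h φ hφ
    obtain ⟨v, hv⟩ := h (fun g => (invariants π).mkQ (φ g)) hφ.mkQ_mul
    obtain ⟨x, rfl⟩ := (invariants π).mkQ_surjective v
    refine ⟨x, funext fun g => sub_eq_zero.1
      (additive_map_eq_zero hhom (fun g => φ g - cob1 π x g) (fun a b => ?_) g)⟩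
    rw [← sub_eq_zero, hφ.sub_cob1_mul, sub_eq_zero]
    have hmem : φ b - cob1 π x b ∈ invariants π := by
      rw [← Submodule.ker_mkQ (invariants π), LinearMap.mem_ker, map_sub, mkQ_cob1, sub_eq_zero]
      exact congrFun hv b
    exact hmem a
  · intro h φ hφ
    let B : X → G → X ⧸ invariants π := fun x g => (invariants π).mkQ (cob1 π x g)
    let l := Filter.comap B (nhds fun g => (invariants π).mkQ (φ g))
    have hB : Set.range (fun v : X ⧸ invariants π => fun g => v - pibar π g v) ⊆ Set.range B := by
      rintro _ ⟨v, rfl⟩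
      obtain ⟨x, rfl⟩ := (invariants π).mkQ_surjective v
      exact ⟨x, funext (mkQ_cob1 π x)⟩
    have : l.NeBot := by
      refine Filter.comap_neBot fun t ht => ?_
      obtain ⟨_, hy, x, rfl⟩ := mem_closure_iff_nhds.1
        (closure_mono hB (h (fun g => (invariants π).mkQ (φ g)) hφ.mkQ_mul)) t ht
      exact ⟨x, hy⟩
    have hlim (g : G) :
        Filter.Tendsto (fun x => (invariants π).mkQ (φ g - cob1 π x g)) l (nhds 0) := by
      have hBl : Filter.Tendsto B l (nhds fun g => (invariants π).mkQ (φ g)) :=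
        Filter.tendsto_comap
      have := (tendsto_pi_nhds.1 hBl g).const_sub ((invariants π).mkQ (φ g))
      simpa only [map_sub, sub_self] using this
    have hzero := tendsto_zero_of_asymptotically_additive l hhom
      (fun g x => φ g - cob1 π x g) fun a b =>
        (tendsto_action_sub_self π (hlim b) a).congr fun x => (hφ.sub_cob1_mul x a b).symm
    refine mem_closure_of_tendsto (f := cob1 π) (b := l) (tendsto_pi_nhds.2 fun g => ?_)
      (Filter.Eventually.of_forall fun x => Set.mem_range_self x)
    simpa using (hzero g).const_sub (φ g)
end
end

section
/- Let G be a countable group and (X,π) an isometric Banach G-module. Then the following are equivalent: (1) B¹(G,X) is closed in Z¹(G,X); (2) the induced isometric Banach G-module (X/X^G, π̄) does not have almost invariant unit vectors. -/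
noncomputable section

open scoped BigOperators

variable {G : Type*} [Group G] {X : Type*} [NormedAddCommGroup X] [NormedSpace ℝ X]

lemma isClosed_invariants (π : G →* (X →L[ℝ] X)) : IsClosed (invariants π : Set X) := by
  have h : (invariants π : Set X) = ⋂ g, {x | π g x = x} := by
    ext x
    simp [invariants]
  rw [h]
  exact isClosed_iInter fun g => isClosed_eq (π g).continuous continuous_id

lemma norm_sub_apply_pow_sub_nsmul_le {π : G →* (X →L[ℝ] X)}
    (hiso : ∀ (g : G) (x : X), ‖π g x‖ = ‖x‖) (g : G) (x : X) {y : X}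
    (hy : y ∈ invariants π) (n : ℕ) :
    ‖x - π (g ^ n) x - n • y‖ ≤ n * ‖x - π g x - y‖ := by
  induction n with
  | zero => simp
  | succ n ih =>
    have h : x - π (g ^ (n + 1)) x - (n + 1) • y
        = (x - π g x - y) + π g (x - π (g ^ n) x - n • y) := by
      rw [pow_succ', map_mul, mul_apply_eq_comp, map_sub, map_sub, map_nsmul, hy g,
        succ_nsmul]
      abel
    rw [h]
    refine (norm_add_le _ _).trans ?_
    rw [hiso]
    push_cast
    linarith

/-- The invariant part of a displacement is controlled by the remainder: telescoping along the
powers of `g` would otherwise make `x - π (g ^ n) x` unbounded. -/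
lemma norm_le_norm_sub_apply_sub {π : G →* (X →L[ℝ] X)}
    (hiso : ∀ (g : G) (x : X), ‖π g x‖ = ‖x‖) (g : G) (x : X) {y : X}
    (hy : y ∈ invariants π) : ‖y‖ ≤ ‖x - π g x - y‖ := by
  by_contra! hlt
  obtain ⟨n, hn⟩ := exists_nat_gt (2 * ‖x‖ / (‖y‖ - ‖x - π g x - y‖))
  rw [div_lt_iff₀ (sub_pos.2 hlt)] at hn
  have h1 := norm_sub_apply_pow_sub_nsmul_le hiso g x hy n
  have h2 : ‖n • y‖ ≤ ‖x - π (g ^ n) x‖ + ‖x - π (g ^ n) x - n • y‖ := by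
    simpa using norm_sub_le (x - π (g ^ n) x) (x - π (g ^ n) x - n • y)
  have h3 : ‖x - π (g ^ n) x‖ ≤ 2 * ‖x‖ := by
    have := norm_sub_le x (π (g ^ n) x)
    rw [hiso] at this
    linarith
  rw [← Nat.cast_smul_eq_nsmul ℝ, norm_smul, Real.norm_natCast, Nat.cast_smul_eq_nsmul] at h2
  linarith

/-- The map `X / X^G → X` induced by `x ↦ x - π(g)x`. -/
def displacement (π : G →* (X →L[ℝ] X)) (g : G) : (X ⧸ invariants π) →ₗ[ℝ] X :=
  (invariants π).liftQ (LinearMap.id - (π g).toLinearMap) fun x hx => by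
    simp [hx g]

@[simp]
lemma displacement_mk (π : G →* (X →L[ℝ] X)) (g : G) (x : X) :
    displacement π g (Submodule.Quotient.mk x) = x - π g x := rfl

lemma norm_displacement_le {π : G →* (X →L[ℝ] X)} (hiso : ∀ (g : G) (x : X), ‖π g x‖ = ‖x‖)
    (g : G) (v : X ⧸ invariants π) : ‖displacement π g v‖ ≤ 2 * ‖v‖ := by
  refine le_of_forall_pos_le_add fun ε hε => ?_
  obtain ⟨x, rfl, hx⟩ := Submodule.Quotient.norm_mk_lt v (half_pos hε)
  have := norm_sub_le x (π g x)
  rw [hiso] at this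
  rw [displacement_mk]
  linarith

lemma norm_sub_pibar_le (π : G →* (X →L[ℝ] X)) (g : G) (v : X ⧸ invariants π) :
    ‖v - pibar π g v‖ ≤ ‖displacement π g v‖ := by
  obtain ⟨x, rfl⟩ := Submodule.Quotient.mk_surjective _ v
  exact Submodule.Quotient.norm_mk_le (invariants π) (x - π g x)

lemma norm_displacement_le_norm_sub_pibar {π : G →* (X →L[ℝ] X)}
    (hiso : ∀ (g : G) (x : X), ‖π g x‖ = ‖x‖) (g : G) (v : X ⧸ invariants π) :
    ‖displacement π g v‖ ≤ 2 * ‖v - pibar π g v‖ := by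
  obtain ⟨x, rfl⟩ := Submodule.Quotient.mk_surjective _ v
  refine le_of_forall_pos_le_add fun ε hε => ?_
  obtain ⟨m, hm, hlt⟩ := Submodule.Quotient.norm_mk_lt
    (Submodule.Quotient.mk x - pibar π g (Submodule.Quotient.mk x)) (half_pos hε)
  have hy : x - π g x - m ∈ invariants π :=
    (Submodule.Quotient.eq (invariants π)).1
      (show Submodule.Quotient.mk (x - π g x) = Submodule.Quotient.mk m from hm.symm)
  have h1 := norm_le_norm_sub_apply_sub hiso g x hy
  rw [sub_sub_cancel] at h1
  have h2 := norm_add_le (x - π g x - m) m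
  rw [sub_add_cancel] at h2
  rw [displacement_mk]
  linarith

lemma displacement_injective (π : G →* (X →L[ℝ] X)) {v : X ⧸ invariants π}
    (hv : ∀ g, displacement π g v = 0) : v = 0 := by
  obtain ⟨x, rfl⟩ := Submodule.Quotient.mk_surjective _ v
  exact (Submodule.Quotient.mk_eq_zero _).2 fun g => (sub_eq_zero.1 (hv g)).symm

lemma range_cob1 (π : G →* (X →L[ℝ] X)) :
    Set.range (cob1 π) = Set.range fun v g => displacement π g v := by
  ext φ
  constructor
  · rintro ⟨x, rfl⟩
    exact ⟨Submodule.Quotient.mk x, rfl⟩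
  · rintro ⟨v, rfl⟩
    obtain ⟨x, rfl⟩ := Submodule.Quotient.mk_surjective _ v
    exact ⟨x, rfl⟩

lemma isCocycle_cob1 (π : G →* (X →L[ℝ] X)) (x : X) : IsCocycle π (cob1 π x) := by
  intro g f
  simp [cob1]

lemma isClosed_setOf_isCocycle (π : G →* (X →L[ℝ] X)) : IsClosed {φ | IsCocycle π φ} := by
  simp only [IsCocycle, Set.ofPred_forall]
  refine isClosed_iInter fun g => isClosed_iInter fun f => isClosed_eq (by fun_prop) ?_
  exact ((π g).continuous.comp (continuous_apply f)).add (continuous_apply g)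

lemma isClosed_range_cob1_iff (π : G →* (X →L[ℝ] X)) :
    IsClosed (Set.range (cob1 π)) ↔
      ∀ φ : G → X, IsCocycle π φ → φ ∈ closure (Set.range (cob1 π)) →
        φ ∈ Set.range (cob1 π) := by
  refine ⟨fun h φ _ hφ => h.closure_eq ▸ hφ, fun h => isClosed_of_closure_subset fun φ hφ => ?_⟩
  refine h φ (closure_minimal ?_ (isClosed_setOf_isCocycle π) hφ) hφ
  rintro _ ⟨x, rfl⟩
  exact isCocycle_cob1 π x

lemma isClosed_range_displacement_of_bound [CompleteSpace X] {π : G →* (X →L[ℝ] X)}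
    (hiso : ∀ (g : G) (x : X), ‖π g x‖ = ‖x‖) {E : Finset G} {ε : ℝ} (hε : 0 < ε)
    (h : ∀ v : X ⧸ invariants π, ‖v‖ = 1 → ∃ g ∈ E, ε ≤ ‖displacement π g v‖) :
    IsClosed (Set.range fun (v : X ⧸ invariants π) g => displacement π g v) := by
  have := isClosed_invariants π
  let D (g : G) : (X ⧸ invariants π) →L[ℝ] X :=
    (displacement π g).mkContinuous 2 (norm_displacement_le hiso g)
  let T : (X ⧸ invariants π) →L[ℝ] (G → X) := ContinuousLinearMap.pi D
  let S : (X ⧸ invariants π) →L[ℝ] (E → X) := ContinuousLinearMap.pi fun g => D g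
  have hS : AntilipschitzWith (ε⁻¹).toNNReal S := by
    refine S.antilipschitz_of_bound fun v => ?_
    rw [Real.coe_toNNReal _ (inv_pos.2 hε).le]
    rcases eq_or_ne v 0 with rfl | hv
    · simp
    obtain ⟨g, hg, hle⟩ := h (‖v‖⁻¹ • v) (norm_smul_inv_norm (𝕜 := ℝ) hv)
    rw [map_smul, norm_smul, norm_inv, norm_norm, ← div_eq_inv_mul,
      le_div_iff₀ (norm_pos_iff.2 hv)] at hle
    rw [← div_eq_inv_mul, le_div_iff₀ hε, mul_comm]
    exact hle.trans (norm_le_pi_norm (S v) ⟨g, hg⟩)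
  have hT : IsUniformInducing T :=
    .of_comp (g := fun φ (g : E) => φ g) T.uniformContinuous
      (uniformContinuous_pi.2 fun g => Pi.uniformContinuous_proj _ _)
      (hS.isUniformInducing S.uniformContinuous)
  exact hT.isComplete_range.isClosed

/-- Closed range of the displacement map upgrades, by the open mapping theorem applied to a weighted
embedding into `ℓ^∞(G, X)`, to a uniform lower bound. -/
lemma exists_bound_of_isClosed_range_displacement [CompleteSpace X] {π : G →* (X →L[ℝ] X)}
    (hiso : ∀ (g : G) (x : X), ‖π g x‖ = ‖x‖) {w : G → ℝ} (hw : ∀ g, 0 < w g)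
    (hw1 : ∀ g, w g ≤ 1)
    (h : IsClosed (Set.range fun (v : X ⧸ invariants π) g => displacement π g v)) :
    ∃ K : ℝ, 0 < K ∧ ∀ (v : X ⧸ invariants π) (C : ℝ), 0 ≤ C →
      (∀ g, w g * ‖displacement π g v‖ ≤ C) → ‖v‖ ≤ K * C := by
  have := isClosed_invariants π
  have hbound (v : X ⧸ invariants π) (g : G) : ‖w g • displacement π g v‖ ≤ 2 * ‖v‖ := by
    rw [norm_smul, Real.norm_of_nonneg (hw g).le]
    exact (mul_le_of_le_one_left (norm_nonneg _) (hw1 g)).trans (norm_displacement_le hiso g v)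
  let L : (X ⧸ invariants π) →ₗ[ℝ] lp (fun _ : G => X) ⊤ :=
    { toFun v := ⟨fun g => w g • displacement π g v,
        memℓp_infty ⟨2 * ‖v‖, Set.forall_mem_range.2 (hbound v)⟩⟩
      map_add' u v := by
        ext g
        exact (congrArg (w g • ·) (map_add _ u v)).trans (smul_add _ _ _)
      map_smul' c v := by
        ext g
        simp [smul_comm c] }
  let W := L.mkContinuous 2 fun v =>
    lp.norm_le_of_forall_le (by positivity) (hbound v)
  have hW (v : X ⧸ invariants π) (g : G) : W v g = w g • displacement π g v := rfl
  have hinj : Function.Injective W := by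
    refine (injective_iff_map_eq_zero W).2 fun v hv => displacement_injective π fun g => ?_
    have hg := hW v g
    rw [hv] at hg
    exact (smul_eq_zero.1 hg.symm).resolve_left (hw g).ne'
  have hcont : Continuous fun (ψ : lp (fun _ : G => X) ⊤) g => (w g)⁻¹ • ψ g :=
    continuous_pi fun g =>
      ((continuous_apply g).comp lp.uniformContinuous_coe.continuous).const_smul _
  have hrange : Set.range W = (fun (ψ : lp (fun _ : G => X) ⊤) g => (w g)⁻¹ • ψ g) ⁻¹'
      Set.range fun v g => displacement π g v := by
    ext ψ
    constructor
    · rintro ⟨v, rfl⟩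
      exact ⟨v, funext fun g => by simp [hW, smul_smul, (hw g).ne']⟩
    · rintro ⟨v, hv⟩
      refine ⟨v, lp.ext <| funext fun g => ?_⟩
      have hg : displacement π g v = (w g)⁻¹ • ψ g := congrFun hv g
      rw [hW, hg, smul_smul, mul_inv_cancel₀ (hw g).ne', one_smul]
  obtain ⟨K, hK⟩ := W.antilipschitz_of_injective_of_isClosed_range hinj
    (hrange ▸ h.preimage hcont)
  refine ⟨K + 1, by positivity, fun v C hC hv => ?_⟩
  have h1 : ‖v‖ ≤ K * ‖W v‖ := hK.le_mul_norm (map_zero W) v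
  have h2 : ‖W v‖ ≤ C := lp.norm_le_of_forall_le hC fun g => by
    rw [hW, norm_smul, Real.norm_of_nonneg (hw g).le]
    exact hv g
  have h3 : K * ‖W v‖ ≤ K * C := by gcongr
  linarith

/-- (Guichardet) For a countable group `G` and an isometric Banach `G`-module `(X,π)`,
the space `B¹(G,X)` is closed in `Z¹(G,X)` (in the topology of pointwise convergence)
if and only if the quotient module `(X/X^G, π̄)` has no almost invariant unit vectors. -/
theorem B1_closed_iff_quotient_no_aiuv [Countable G] [CompleteSpace X]
    (π : G →* (X →L[ℝ] X)) (hiso : ∀ (g : G) (x : X), ‖π g x‖ = ‖x‖) :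
    (∀ φ : G → X, IsCocycle π φ → φ ∈ closure (Set.range (cob1 π)) →
        φ ∈ Set.range (cob1 π)) ↔
      ¬ (∀ (E : Finset G) (ε : ℝ), 0 < ε →
          ∃ v : X ⧸ invariants π, ‖v‖ = 1 ∧ ∀ g ∈ E, ‖v - pibar π g v‖ < ε) := by
  rw [← isClosed_range_cob1_iff, range_cob1]
  constructor
  · intro hclosed haiuv
    have := Encodable.ofCountable G
    obtain ⟨w, hw, c, hwc, hc⟩ := posSumOfEncodable one_pos G
    have hw1 (g : G) : w g ≤ 1 := (le_hasSum hwc g fun j _ => (hw j).le).trans hc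
    obtain ⟨K, hK, hbound⟩ := exists_bound_of_isClosed_range_displacement hiso hw hw1 hclosed
    have hδ : 0 < 1 / (4 * K) := by positivity
    have hfin : {g | ¬ w g < 1 / (4 * K)}.Finite :=
      hwc.summable.tendsto_cofinite_zero.eventually_lt_const hδ
    obtain ⟨v, hv, hsmall⟩ := haiuv hfin.toFinset (1 / (4 * K)) hδ
    have h1 := hbound v (2 * (1 / (4 * K))) (by positivity) fun g => by
      by_cases hg : w g < 1 / (4 * K)
      · have h2 := norm_displacement_le hiso g v
        rw [hv, mul_one] at h2
        rw [mul_comm 2]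
        exact mul_le_mul hg.le h2 (norm_nonneg _) hδ.le
      · have h2 := norm_displacement_le_norm_sub_pibar hiso g v
        have h3 := hsmall g (hfin.mem_toFinset.2 hg)
        exact (mul_le_of_le_one_left (norm_nonneg _) (hw1 g)).trans (by linarith)
    have h4 : K * (2 * (1 / (4 * K))) = 1 / 2 := by
      field_simp
      norm_num
    linarith
  · intro h
    push Not at h
    obtain ⟨E, ε, hε, h⟩ := h
    refine isClosed_range_displacement_of_bound hiso (E := E) hε fun v hv => ?_
    obtain ⟨g, hg, hle⟩ := h v hv
    exact ⟨g, hg, hle.trans (norm_sub_pibar_le π g v)⟩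
end
end
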